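/- The set 𝒴 = {y ∈ ℝ : y > 1 and δ_y = 0} is Lebesgue measurable and has Lebesgue measure zero. In other words, for Lebesgue-almost all real numbers y > 1, the lower asymptotic density of the set of positive integers of the form p + ⌊y^k⌋ (with p prime and k a positive integer) is strictly positive. -/

import Mathlib

open MeasureTheory Filter

/-- `Sy y` is the set of natural numbers of the form `p + ⌊y^k⌋` with `p` prime and
`k` a positive integer. -/
def Sy (y : ℝ) : Set ℕ :=
  {n : ℕ | ∃ p k : ℕ, p.Prime ∧ 1 ≤ k ∧ (n : ℤ) = (p : ℤ) + ⌊y ^ k⌋}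

/-- `delta y` is the lower asymptotic density of `Sy y`:
`liminf_{N→∞} |Sy y ∩ [1,N]| / N`. -/
noncomputable def delta (y : ℝ) : ℝ :=
  Filter.liminf (fun N : ℕ =>
    (Nat.card {n : ℕ | n ∈ Sy y ∧ n ∈ Set.Icc 1 N} : ℝ) / (N : ℝ)) Filter.atTop

section
open Finset
open scoped ArithmeticFunction.Moebius

lemma rom_sum_moebius {l m : ℕ} (hm : Squarefree m) (hlm : l ∣ m) :
    (∑ d ∈ m.divisors.filter (fun d => l ∣ d), (ArithmeticFunction.moebius d : ℝ))
      = if m = l then (ArithmeticFunction.moebius l : ℝ) else 0 := by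
  obtain ⟨e, rfl⟩ := hlm
  have hl0 : l ≠ 0 := by rintro rfl; simp at hm
  have he0 : e ≠ 0 := by rintro rfl; simp at hm
  have h1 : (l * e).divisors.filter (fun d => l ∣ d) = e.divisors.image (fun d => l * d) := by
    ext d
    simp only [Finset.mem_filter, Nat.mem_divisors, Finset.mem_image]
    constructor
    · rintro ⟨⟨h, h0⟩, k, rfl⟩
      exact ⟨k, ⟨Nat.dvd_of_mul_dvd_mul_left (Nat.pos_of_ne_zero hl0) h, he0⟩, rfl⟩
    · rintro ⟨k, ⟨h, h0⟩, rfl⟩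
      exact ⟨⟨Nat.mul_dvd_mul_left _ h, by positivity⟩, Dvd.intro _ rfl⟩
  rw [h1, Finset.sum_image (by intro a _ b _ h; exact Nat.eq_of_mul_eq_mul_left (Nat.pos_of_ne_zero hl0) h)]
  have hcop : Nat.Coprime l e := Nat.coprime_of_squarefree_mul hm
  have h2 : ∀ d ∈ e.divisors, (ArithmeticFunction.moebius (l * d) : ℝ)
      = (ArithmeticFunction.moebius l : ℝ) * (ArithmeticFunction.moebius d : ℝ) := by
    intro d hd
    rw [ArithmeticFunction.isMultiplicative_moebius.map_mul_of_coprime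
      (Nat.Coprime.coprime_dvd_right (Nat.dvd_of_mem_divisors hd) hcop)]
    push_cast; ring
  rw [Finset.sum_congr rfl h2, ← Finset.mul_sum]
  have h3 : (∑ d ∈ e.divisors, (ArithmeticFunction.moebius d : ℝ)) = if e = 1 then 1 else 0 := by
    have h := congrArg (fun f : ArithmeticFunction ℤ => f e) ArithmeticFunction.moebius_mul_coe_zeta
    simp only [ArithmeticFunction.coe_mul_zeta_apply, ArithmeticFunction.one_apply] at h
    rw [← Int.cast_sum, h]; split_ifs <;> simp
  rw [h3]
  by_cases he : e = 1
  · simp [he]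
  · have : l * e ≠ l := by
      intro h; apply he
      have : l * e = l * 1 := by simpa using h
      exact Nat.eq_of_mul_eq_mul_left (Nat.pos_of_ne_zero hl0) this
    simp [he, this]

/-- Selberg upper bound -/
theorem rom_selberg (s : BoundingSieve) (z : ℕ) (hz : 1 ≤ z) :
    s.siftedSum ≤ s.totalMass * (∑ l ∈ s.prodPrimes.divisors.filter (· ≤ z), s.selbergTerms l)⁻¹
      + ∑ d1 ∈ s.prodPrimes.divisors.filter (· ≤ z), ∑ d2 ∈ s.prodPrimes.divisors.filter (· ≤ z),
        (s.nu d1)⁻¹ * (s.nu d2)⁻¹ * |s.rem (d1.lcm d2)| := by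
  set D := s.prodPrimes.divisors with hD
  set S := ∑ l ∈ D.filter (· ≤ z), s.selbergTerms l with hS
  have hP0 := s.prodPrimes_ne_zero
  have hgpos : ∀ l ∈ D, 0 < s.selbergTerms l := fun l hl =>
    BoundingSieve.selbergTerms_pos (Nat.dvd_of_mem_divisors hl)
  have hSpos : 0 < S := by
    apply Finset.sum_pos
    · intro l hl; exact hgpos l (Finset.mem_filter.1 hl).1
    · exact ⟨1, by simp [hD, hz, hP0]⟩
  have hnupos : ∀ d ∈ D, 0 < s.nu d := fun d hd =>
    BoundingSieve.nu_pos_of_dvd_prodPrimes (Nat.dvd_of_mem_divisors hd)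
  let w : ℕ → ℝ := fun d => (ArithmeticFunction.moebius d : ℝ) * (s.nu d)⁻¹ * S⁻¹ *
    ∑ m ∈ (D.filter (· ≤ z)).filter (fun m => d ∣ m), s.selbergTerms m
  have hw1 : w 1 = 1 := by
    simp only [w]
    have : (D.filter (· ≤ z)).filter (fun m => 1 ∣ m) = D.filter (· ≤ z) := by
      apply Finset.filter_true_of_mem; simp
    rw [this, ← hS, s.nu_mult.map_one]
    simp [hSpos.ne']
  have hwabs : ∀ d ∈ D, |w d| ≤ if d ≤ z then (s.nu d)⁻¹ else 0 := by
    intro d hd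
    simp only [w]
    split_ifs with hdz
    · rw [abs_mul, abs_mul, abs_mul]
      have h1 : |(ArithmeticFunction.moebius d : ℝ)| ≤ 1 := by
        have := ArithmeticFunction.abs_moebius_le_one (n := d)
        exact_mod_cast this
      have h2 : |(s.nu d)⁻¹| = (s.nu d)⁻¹ := abs_of_pos (inv_pos.2 (hnupos d hd))
      have h3 : |S⁻¹| = S⁻¹ := abs_of_pos (inv_pos.2 hSpos)
      have h5 : 0 ≤ ∑ m ∈ (D.filter (· ≤ z)).filter (fun m => d ∣ m), s.selbergTerms m := by
        apply Finset.sum_nonneg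
        intro m hm
        exact (hgpos m (Finset.mem_filter.1 (Finset.mem_filter.1 hm).1).1).le
      have h4 : ∑ m ∈ (D.filter (· ≤ z)).filter (fun m => d ∣ m), s.selbergTerms m ≤ S := by
        apply Finset.sum_le_sum_of_subset_of_nonneg (Finset.filter_subset _ _)
        intro m hm _
        exact (hgpos m (Finset.mem_filter.1 hm).1).le
      rw [h2, h3, abs_of_nonneg h5]
      have hn := inv_pos.2 (hnupos d hd)
      calc _ ≤ 1 * (s.nu d)⁻¹ * S⁻¹ * S := by gcongr
        _ = _ := by field_simp
    · have : (D.filter (· ≤ z)).filter (fun m => d ∣ m) = ∅ := by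
        apply Finset.filter_eq_empty_iff.2
        intro m hm hdm
        have hm' := Finset.mem_filter.1 hm
        have := Nat.le_of_dvd (Nat.pos_of_mem_divisors hm'.1) hdm
        omega
      rw [this]; simp
  have hy : ∀ l ∈ D, (∑ d ∈ D, if l ∣ d then s.nu d * w d else 0)
      = if l ≤ z then S⁻¹ * s.selbergTerms l * (ArithmeticFunction.moebius l : ℝ) else 0 := by
    intro l hl
    have e1 : ∀ d ∈ D, (if l ∣ d then s.nu d * w d else 0)
        = ∑ m ∈ D.filter (· ≤ z), S⁻¹ * s.selbergTerms m *
            (if l ∣ d ∧ d ∣ m then (ArithmeticFunction.moebius d : ℝ) else 0) := by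
      intro d hd
      split_ifs with hld
      · simp only [w]
        have := (hnupos d hd).ne'
        rw [Finset.sum_filter]
        rw [Finset.mul_sum, Finset.mul_sum]
        apply Finset.sum_congr rfl
        intro m hm
        by_cases hdm : d ∣ m
        · simp [hld, hdm]; field_simp
        · simp [hdm]
      · simp [hld]
    rw [Finset.sum_congr rfl e1, Finset.sum_comm]
    have e2 : ∀ m ∈ D.filter (· ≤ z), (∑ d ∈ D, S⁻¹ * s.selbergTerms m *
            (if l ∣ d ∧ d ∣ m then (ArithmeticFunction.moebius d : ℝ) else 0))
        = if m = l then S⁻¹ * s.selbergTerms l * (ArithmeticFunction.moebius l : ℝ) else 0 := by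
      intro m hm
      have hmD := (Finset.mem_filter.1 hm).1
      have hmP := Nat.dvd_of_mem_divisors hmD
      rw [← Finset.mul_sum, ← Finset.sum_filter]
      have e3 : D.filter (fun d => l ∣ d ∧ d ∣ m) = m.divisors.filter (fun d => l ∣ d) := by
        ext d
        simp only [Finset.mem_filter, hD, Nat.mem_divisors]
        constructor
        · rintro ⟨h1, h2, h3⟩
          exact ⟨⟨h3, (Nat.pos_of_mem_divisors hmD).ne'⟩, h2⟩
        · rintro ⟨⟨h1, h2⟩, h3⟩
          exact ⟨⟨h1.trans hmP, hP0⟩, h3, h1⟩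
      rw [e3]
      by_cases hlm : l ∣ m
      · rw [rom_sum_moebius (s.squarefree_of_dvd_prodPrimes hmP) hlm]
        split_ifs with h
        · rw [h]
        · simp
      · have : m ≠ l := by rintro rfl; exact hlm dvd_rfl
        rw [if_neg this]
        have : m.divisors.filter (fun d => l ∣ d) = ∅ := by
          apply Finset.filter_eq_empty_iff.2
          intro d hd hld
          exact hlm (hld.trans (Nat.dvd_of_mem_divisors hd))
        rw [this]; simp
    rw [Finset.sum_congr rfl e2]
    rw [Finset.sum_ite_eq' ]
    simp [hl]
  have hmain : s.mainSum (BoundingSieve.lambdaSquared w) = S⁻¹ := by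
    rw [BoundingSieve.mainSum_lambdaSquared_eq_sum_mul_sum_sq]
    have e1 : ∀ l ∈ D, (s.selbergTerms l)⁻¹ *
        (∑ d ∈ D, if l ∣ d then s.nu d * w d else 0) ^ 2
        = if l ≤ z then S⁻¹ ^ 2 * s.selbergTerms l else 0 := by
      intro l hl
      rw [hy l hl]
      split_ifs
      · have hsq : Squarefree l := s.squarefree_of_dvd_prodPrimes (Nat.dvd_of_mem_divisors hl)
        have h1 : (ArithmeticFunction.moebius l : ℝ) ^ 2 = 1 := by
          have := ArithmeticFunction.moebius_sq_eq_one_of_squarefree hsq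
          exact_mod_cast this
        have := (hgpos l hl).ne'
        rw [mul_pow, h1]; field_simp
      · simp
    rw [Finset.sum_congr rfl e1, ← Finset.sum_filter, ← Finset.mul_sum, ← hS]
    field_simp
  have herr : s.errSum (BoundingSieve.lambdaSquared w) ≤
      ∑ d1 ∈ D.filter (· ≤ z), ∑ d2 ∈ D.filter (· ≤ z),
        (s.nu d1)⁻¹ * (s.nu d2)⁻¹ * |s.rem (d1.lcm d2)| := by
    unfold BoundingSieve.errSum BoundingSieve.lambdaSquared
    calc _ ≤ ∑ d ∈ D, ∑ d1 ∈ D, ∑ d2 ∈ D, (if d = d1.lcm d2 then |w d1| * |w d2| * |s.rem d| else 0) := by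
          apply Finset.sum_le_sum
          intro d hd
          have hsub : d.divisors ⊆ D := Nat.divisors_subset_of_dvd hP0 (Nat.dvd_of_mem_divisors hd)
          calc _ ≤ (∑ d1 ∈ d.divisors, ∑ d2 ∈ d.divisors, if d = d1.lcm d2 then |w d1| * |w d2| else 0) * |s.rem d| := by
                gcongr
                refine (Finset.abs_sum_le_sum_abs _ _).trans (Finset.sum_le_sum fun d1 _ => ?_)
                refine (Finset.abs_sum_le_sum_abs _ _).trans (Finset.sum_le_sum fun d2 _ => ?_)
                split_ifs <;> simp [abs_mul]
            _ = ∑ d1 ∈ d.divisors, ∑ d2 ∈ d.divisors, if d = d1.lcm d2 then |w d1| * |w d2| * |s.rem d| else 0 := by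
                simp [Finset.sum_mul]
            _ ≤ ∑ d1 ∈ d.divisors, ∑ d2 ∈ D, if d = d1.lcm d2 then |w d1| * |w d2| * |s.rem d| else 0 := by
                apply Finset.sum_le_sum; intro d1 _
                apply Finset.sum_le_sum_of_subset_of_nonneg hsub
                intros; split_ifs <;> positivity
            _ ≤ _ := by
                apply Finset.sum_le_sum_of_subset_of_nonneg hsub
                intros; apply Finset.sum_nonneg; intros; split_ifs <;> positivity
      _ = ∑ d1 ∈ D, ∑ d2 ∈ D, |w d1| * |w d2| * |s.rem (d1.lcm d2)| := by
          rw [Finset.sum_comm]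
          apply Finset.sum_congr rfl; intro d1 hd1
          rw [Finset.sum_comm]
          apply Finset.sum_congr rfl; intro d2 hd2
          rw [Finset.sum_ite_eq' D (d1.lcm d2) (fun d => |w d1| * |w d2| * |s.rem d|)]
          rw [if_pos]
          rw [hD, Nat.mem_divisors]
          exact ⟨Nat.lcm_dvd (Nat.dvd_of_mem_divisors hd1) (Nat.dvd_of_mem_divisors hd2), hP0⟩
      _ ≤ ∑ d1 ∈ D, ∑ d2 ∈ D, (if d1 ≤ z then (s.nu d1)⁻¹ else 0) * (if d2 ≤ z then (s.nu d2)⁻¹ else 0) * |s.rem (d1.lcm d2)| := by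
          apply Finset.sum_le_sum; intro d1 hd1
          apply Finset.sum_le_sum; intro d2 hd2
          gcongr
          · exact (abs_nonneg _).trans (hwabs d1 hd1)
          · exact hwabs d1 hd1
          · exact hwabs d2 hd2
      _ = _ := by
          simp_rw [Finset.sum_filter]
          apply Finset.sum_congr rfl; intro d1 hd1
          split_ifs with h
          · apply Finset.sum_congr rfl; intro d2 hd2
            split_ifs <;> simp
          · simp
  have := s.siftedSum_le_mainSum_errSum_of_upperMoebius (BoundingSieve.lambdaSquared w)
    (BoundingSieve.upperMoebius_lambdaSquared w hw1)
  rw [hmain] at this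
  linarith

end

section
open Finset

lemma rom_inj {α β : Type*} (A : Finset α) (B : Finset β) (φ : α → β) (f : α → ℝ) (g : β → ℝ)
    (hφ : ∀ a ∈ A, φ a ∈ B) (inj : Set.InjOn φ A) (hfg : ∀ a ∈ A, f a ≤ g (φ a))
    (hg : ∀ b ∈ B, 0 ≤ g b) : ∑ a ∈ A, f a ≤ ∑ b ∈ B, g b := by
  classical
  calc ∑ a ∈ A, f a ≤ ∑ a ∈ A, g (φ a) := Finset.sum_le_sum hfg
    _ = ∑ b ∈ A.image φ, g b := (Finset.sum_image inj).symm
    _ ≤ _ := Finset.sum_le_sum_of_subset_of_nonneg (Finset.image_subset_iff.2 hφ)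
        (fun b hb _ => hg b hb)

/-- indicator of being coprime to h -/
noncomputable def romChi (h : ℕ) : ArithmeticFunction ℝ :=
  ⟨fun d => if d = 0 then 0 else if Nat.Coprime d h then 1 else 0, by simp⟩

lemma romChi_apply (h d : ℕ) (hd : d ≠ 0) : romChi h d = if Nat.Coprime d h then 1 else 0 := by
  simp [romChi, hd]

lemma romChi_mult (h : ℕ) : (romChi h).IsMultiplicative := by
  rw [ArithmeticFunction.IsMultiplicative.iff_ne_zero]
  refine ⟨by simp [romChi], ?_⟩
  intro m n hm hn _
  rw [romChi_apply _ _ (mul_ne_zero hm hn), romChi_apply _ _ hm, romChi_apply _ _ hn]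
  simp only [Nat.coprime_mul_iff_left]
  split_ifs <;> first | tauto | norm_num

noncomputable def romOm (h : ℕ) : ArithmeticFunction ℝ :=
  romChi h * ((ArithmeticFunction.zeta : ArithmeticFunction ℕ) : ArithmeticFunction ℝ)

lemma romOm_mult (h : ℕ) : (romOm h).IsMultiplicative :=
  (romChi_mult h).mul ArithmeticFunction.isMultiplicative_zeta.natCast

lemma romOm_apply (h d : ℕ) :
    romOm h d = ((d.divisors.filter (fun b => Nat.Coprime b h)).card : ℝ) := by
  unfold romOm
  rw [ArithmeticFunction.coe_mul_zeta_apply, Finset.card_filter]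
  push_cast
  apply Finset.sum_congr rfl
  intro b hb
  exact romChi_apply h b (Nat.pos_of_mem_divisors hb).ne'

lemma romOm_one_le (h d : ℕ) (hd : d ≠ 0) : 1 ≤ romOm h d := by
  rw [romOm_apply]
  have : 0 < (d.divisors.filter (fun b => Nat.Coprime b h)).card :=
    Finset.card_pos.2 ⟨1, by simp [hd]⟩
  exact_mod_cast this

lemma romOm_le (h d : ℕ) : romOm h d ≤ d := by
  rw [romOm_apply]
  exact_mod_cast (Finset.card_filter_le _ _).trans (Nat.card_divisors_le_self d)

noncomputable def romNu (h : ℕ) : ArithmeticFunction ℝ :=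
  (romOm h).pdiv ((ArithmeticFunction.id : ArithmeticFunction ℕ) : ArithmeticFunction ℝ)

lemma romNu_mult (h : ℕ) : (romNu h).IsMultiplicative :=
  (romOm_mult h).pdiv ArithmeticFunction.isMultiplicative_id.natCast

lemma romNu_apply (h d : ℕ) : romNu h d = romOm h d / d := by
  simp [romNu]

lemma rom_count_residue (N d v : ℕ) (hd : 0 < d) :
    |(((Finset.Ioc 0 N).filter (fun n => n ≡ v [MOD d])).card : ℝ) - N / d| ≤ 1 := by
  have h := Nat.Ioc_filter_modEq_card 0 N hd v
  have hd' : (0 : ℝ) < d := by exact_mod_cast hd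
  have key : ((((Finset.Ioc 0 N).filter (fun n => n ≡ v [MOD d])).card : ℤ) : ℝ)
      = ((max (⌊((N : ℚ) - v) / d⌋ - ⌊((0 : ℕ) - v : ℚ) / d⌋) 0 : ℤ) : ℝ) := by
    rw [h]
  have hmono : ⌊((0 : ℕ) - v : ℚ) / d⌋ ≤ ⌊((N : ℚ) - v) / d⌋ := by
    apply Int.floor_le_floor
    gcongr
    simp
  rw [max_eq_left (by linarith)] at key
  rw [Int.cast_natCast] at key
  rw [key]
  have a1 := Int.floor_le (((N : ℚ) - v) / d)
  have a2 := Int.lt_floor_add_one (((N : ℚ) - v) / d)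
  have a3 := Int.floor_le (((0 : ℕ) - v : ℚ) / d)
  have a4 := Int.lt_floor_add_one (((0 : ℕ) - v : ℚ) / d)
  set A := ⌊((N : ℚ) - v) / d⌋
  set B := ⌊((0 : ℕ) - v : ℚ) / d⌋
  have e : ((N : ℚ) - v) / d - ((0 : ℕ) - v : ℚ) / d = (N : ℚ) / d := by
    push_cast; ring
  have b1 : ((A - B : ℤ) : ℚ) - N / d ≤ 1 := by push_cast; linarith
  have b2 : -1 ≤ ((A - B : ℤ) : ℚ) - N / d := by push_cast; linarith
  rw [abs_le]
  have c1 := (Rat.cast_le (K := ℝ)).2 b1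
  have c2 := (Rat.cast_le (K := ℝ)).2 b2
  push_cast at c1 c2 ⊢
  exact ⟨c2, c1⟩

lemma rom_count (N h d : ℕ) (hd : Squarefree d) :
    |(((Finset.Ioc 0 N).filter (fun n => d ∣ n * (n + h))).card : ℝ) - N * romNu h d| ≤ romOm h d := by
  have hd0 : d ≠ 0 := hd.ne_zero
  have hdpos : 0 < d := Nat.pos_of_ne_zero hd0
  set T := d.divisors.filter (fun b => Nat.Coprime b h) with hT
  have hmap : ∀ n ∈ (Finset.Ioc 0 N).filter (fun n => d ∣ n * (n + h)), d / Nat.gcd d n ∈ T := by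
    intro n hn
    obtain ⟨hn1, hn2⟩ := Finset.mem_filter.1 hn
    have hg : Nat.gcd d n ∣ d := Nat.gcd_dvd_left _ _
    obtain ⟨b, hb⟩ := hg
    have hgpos : 0 < Nat.gcd d n := Nat.gcd_pos_of_pos_left _ hdpos
    have hb' : d / Nat.gcd d n = b := Nat.div_eq_of_eq_mul_right hgpos hb
    rw [hb', hT, Finset.mem_filter, Nat.mem_divisors]
    refine ⟨⟨⟨_, by rw [mul_comm]; exact hb⟩, hd0⟩, ?_⟩
    apply Nat.Coprime.symm
    rw [Nat.coprime_comm]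
    apply Nat.coprime_of_dvd
    intro p hp hpb hph
    have hpd : p ∣ d := hpb.trans ⟨_, by rw [mul_comm]; exact hb⟩
    have hpn : p ∣ n := by
      rcases hp.dvd_mul.1 (hpd.trans hn2) with h1 | h1
      · exact h1
      · exact (Nat.dvd_add_left hph).1 h1
    have hpg : p ∣ Nat.gcd d n := Nat.dvd_gcd hpd hpn
    have : p * p ∣ d := by rw [hb]; exact Nat.mul_dvd_mul hpg hpb
    exact hp.one_lt.ne' (Nat.isUnit_iff.1 (hd p this))
  rw [Finset.card_eq_sum_card_fiberwise hmap]
  have hfib : ∀ b ∈ T, |(((((Finset.Ioc 0 N).filter (fun n => d ∣ n * (n + h))).filter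
      (fun n => d / Nat.gcd d n = b)).card : ℕ) : ℝ) - N / d| ≤ 1 := by
    intro b hb
    rw [hT, Finset.mem_filter, Nat.mem_divisors] at hb
    obtain ⟨⟨⟨c, hc⟩, _⟩, hbh⟩ := hb
    have hbpos : 0 < b := by rcases Nat.eq_zero_or_pos b with h0 | h0; · simp [h0] at hc; omega
                             · exact h0
    have hcpos : 0 < c := by rcases Nat.eq_zero_or_pos c with h0 | h0; · simp [h0] at hc; omega
                             · exact h0
    have hbc : Nat.Coprime b c := Nat.coprime_of_squarefree_mul (hc ▸ hd)
    obtain ⟨v, hv1, hv2⟩ := Nat.chineseRemainder hbc ((b - 1) * h) 0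
    have : ((Finset.Ioc 0 N).filter (fun n => d ∣ n * (n + h))).filter
      (fun n => d / Nat.gcd d n = b) = (Finset.Ioc 0 N).filter (fun n => n ≡ v [MOD d]) := by
      ext n
      simp only [Finset.mem_filter]
      have hbmod : n ≡ v [MOD b] ↔ b ∣ n + h := by
        have e1 : n ≡ v [MOD b] ↔ n ≡ (b - 1) * h [MOD b] :=
          ⟨fun H => H.trans hv1, fun H => H.trans hv1.symm⟩
        rw [e1]
        have e2 : n ≡ (b - 1) * h [MOD b] ↔ n + h ≡ (b - 1) * h + h [MOD b] :=
          ⟨fun H => H.add_right h, fun H => Nat.ModEq.add_right_cancel' h H⟩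
        rw [e2]
        have e3 : (b - 1) * h + h = b * h := by
          obtain ⟨b', rfl⟩ : ∃ b', b = b' + 1 := ⟨b - 1, by omega⟩
          simp; ring
        rw [e3, ← Nat.modEq_zero_iff_dvd]
        have e4 : b * h ≡ 0 [MOD b] := (Nat.modEq_zero_iff_dvd).2 (Dvd.intro _ rfl)
        exact ⟨fun H => H.trans e4, fun H => H.trans e4.symm⟩
      have hcmod : n ≡ v [MOD c] ↔ c ∣ n := by
        rw [← Nat.modEq_zero_iff_dvd]
        exact ⟨fun H => H.trans hv2, fun H => H.trans hv2.symm⟩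
      rw [hc, ← Nat.modEq_and_modEq_iff_modEq_mul hbc, hbmod, hcmod, and_assoc]
      apply and_congr_right
      intro hn
      constructor
      · rintro ⟨h1, h2⟩
        have hgc : Nat.gcd (b * c) n = c := by
          have hgd : Nat.gcd (b * c) n ∣ b * c := Nat.gcd_dvd_left _ _
          have := Nat.div_mul_cancel hgd
          rw [h2] at this
          exact Nat.eq_of_mul_eq_mul_left hbpos this
        have hcn : c ∣ n := hgc ▸ Nat.gcd_dvd_right (b * c) n
        refine ⟨?_, hcn⟩
        have hbn : Nat.Coprime b n := by
          apply Nat.coprime_of_dvd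
          intro p hp hpb hpn
          have : p ∣ c := by rw [← hgc]; exact Nat.dvd_gcd (hpb.mul_right c) hpn
          exact hp.one_lt.ne' (Nat.dvd_one.1 (hbc ▸ Nat.dvd_gcd hpb this))
        exact hbn.dvd_of_dvd_mul_left ((Dvd.intro _ rfl : b ∣ b * c).trans h1)
      · rintro ⟨h1, h2⟩
        have hbn : Nat.Coprime b n := by
          apply Nat.coprime_of_dvd
          intro p hp hpb hpn
          have : p ∣ h := (Nat.dvd_add_right hpn).1 (hpb.trans h1)
          exact hp.one_lt.ne' (Nat.dvd_one.1 (hbh ▸ Nat.dvd_gcd hpb this))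
        refine ⟨?_, ?_⟩
        · rw [mul_comm b c]; exact Nat.mul_dvd_mul h2 h1
        · have : Nat.gcd (b * c) n = c := by
            rw [Nat.Coprime.gcd_mul_left_cancel c hbn]
            exact Nat.gcd_eq_left h2
          rw [this]; exact Nat.mul_div_cancel b hcpos
    rw [this]
    exact rom_count_residue N d v hdpos
  have e : (N : ℝ) * romNu h d = ∑ b ∈ T, (N : ℝ) / d := by
    rw [romNu_apply, romOm_apply, Finset.sum_const, nsmul_eq_mul]; ring
  rw [e]; push_cast
  rw [← Finset.sum_sub_distrib]
  refine (Finset.abs_sum_le_sum_abs _ _).trans ?_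
  calc _ ≤ ∑ b ∈ T, (1 : ℝ) := Finset.sum_le_sum hfib
    _ = _ := by rw [romOm_apply]; simp [hT]

end

section
open Finset

lemma rom_sum_inv_sq (x : ℕ) : ∑ b ∈ Finset.Icc 1 x, (1 : ℝ) / (b : ℝ) ^ 2 ≤ 2 := by
  have : ∀ x : ℕ, ∑ b ∈ Finset.Icc 1 (x + 1), (1 : ℝ) / (b : ℝ) ^ 2 ≤ 2 - 1 / (x + 1 : ℝ) := by
    intro x
    induction x with
    | zero => norm_num
    | succ n ih =>
      rw [Finset.sum_Icc_succ_top (by omega)]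
      have h : (1 : ℝ) / ((n + 1 + 1 : ℕ) : ℝ) ^ 2 ≤ 1 / (n + 1 : ℝ) - 1 / (n + 1 + 1 : ℝ) := by
        push_cast
        rw [div_sub_div _ _ (by positivity) (by positivity), div_le_div_iff₀ (by positivity) (by positivity)]
        have : (0 : ℝ) ≤ n := by positivity
        nlinarith
      push_cast at h ⊢
      linarith
  rcases x with _ | x
  · simp
  · have h := this x
    have : (0 : ℝ) ≤ 1 / (x + 1 : ℝ) := by positivity
    linarith

/-- squarefree numbers up to x -/
def romU (x : ℕ) : Finset ℕ := (Finset.Icc 1 x).filter Squarefree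

/-- sum of reciprocals of squarefree divisors -/
noncomputable def romF (h : ℕ) : ℝ := ∑ m ∈ h.divisors.filter Squarefree, (1 : ℝ) / m

lemma rom_L1 (x : ℕ) : ∑ n ∈ Finset.Icc 1 x, (1 : ℝ) / n ≤ 2 * ∑ a ∈ romU x, (1 : ℝ) / a := by
  choose A B hAB hA using Nat.sq_mul_squarefree
  have h1 : ∑ n ∈ Finset.Icc 1 x, (1 : ℝ) / n ≤
      ∑ t ∈ romU x ×ˢ Finset.Icc 1 x, (1 : ℝ) / (t.1 : ℝ) * (1 / (t.2 : ℝ) ^ 2) := by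
    apply rom_inj _ _ (fun n => (A n, B n))
    · intro n hn
      rw [Finset.mem_Icc] at hn
      have h0 := hAB n
      have hA0 : 1 ≤ A n := by
        rcases Nat.eq_zero_or_pos (A n) with h | h
        · rw [h] at h0; omega
        · exact h
      have hB0 : 1 ≤ B n := by
        rcases Nat.eq_zero_or_pos (B n) with h | h
        · rw [h] at h0; simp at h0; omega
        · exact h
      have hAn : A n ≤ n := Nat.le_of_dvd hn.1 ⟨B n ^ 2, by rw [mul_comm]; exact h0.symm⟩
      have hBn : B n ≤ n := Nat.le_of_dvd hn.1 ⟨B n * A n, h0.symm.trans (by ring)⟩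
      simp only [Finset.mem_product, romU, Finset.mem_filter, Finset.mem_Icc]
      exact ⟨⟨⟨hA0, by omega⟩, hA n⟩, hB0, by omega⟩
    · intro n _ m _ hnm
      simp only [Prod.mk.injEq] at hnm
      rw [← hAB n, ← hAB m, hnm.1, hnm.2]
    · intro n _
      apply le_of_eq
      conv_lhs => rw [← hAB n]
      push_cast
      rw [one_div_mul_one_div]; congr 1; ring
    · intros; positivity
  rw [Finset.sum_product] at h1
  simp_rw [← Finset.mul_sum] at h1
  rw [← Finset.sum_mul] at h1
  have h2 := rom_sum_inv_sq x
  have h3 : 0 ≤ ∑ a ∈ romU x, (1 : ℝ) / a := Finset.sum_nonneg (by intros; positivity)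
  nlinarith

lemma rom_L2 (x h : ℕ) (hh : h ≠ 0) : ∑ a ∈ romU x, (1 : ℝ) / a ≤
    romF h * ∑ a ∈ (romU x).filter (fun b => Nat.Coprime b h), (1 : ℝ) / a := by
  unfold romF
  rw [Finset.sum_mul_sum, ← Finset.sum_product']
  apply rom_inj _ _ (fun b => (Nat.gcd b h, b / Nat.gcd b h))
  · intro b hb
    simp only [romU, Finset.mem_filter, Finset.mem_Icc] at hb
    obtain ⟨⟨hb1, hbx⟩, hbs⟩ := hb
    simp only [Finset.mem_product, romU, Finset.mem_filter, Finset.mem_Icc, Nat.mem_divisors]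
    have hg : Nat.gcd b h ∣ b := Nat.gcd_dvd_left _ _
    have hgpos : 0 < Nat.gcd b h := Nat.gcd_pos_of_pos_left _ hb1
    refine ⟨⟨⟨Nat.gcd_dvd_right _ _, hh⟩, hbs.squarefree_of_dvd hg⟩, ⟨⟨?_, ?_⟩, ?_⟩, ?_⟩
    · exact Nat.div_pos (Nat.le_of_dvd hb1 hg) hgpos
    · exact (Nat.div_le_self _ _).trans hbx
    · exact hbs.squarefree_of_dvd (Nat.div_dvd_of_dvd hg)
    · apply Nat.coprime_of_dvd
      intro p hp hpb hph
      have hpb' : p ∣ b := hpb.trans (Nat.div_dvd_of_dvd hg)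
      have : p * p ∣ b := by
        rw [← Nat.div_mul_cancel hg]
        exact Nat.mul_dvd_mul hpb (Nat.dvd_gcd hpb' hph)
      exact hp.one_lt.ne' (Nat.isUnit_iff.1 (hbs p this))
  · intro b hb c hc hbc
    simp only [Prod.mk.injEq] at hbc
    rw [← Nat.div_mul_cancel (Nat.gcd_dvd_left b h), ← Nat.div_mul_cancel (Nat.gcd_dvd_left c h), hbc.2, hbc.1]
  · intro b hb
    apply le_of_eq
    conv_lhs => rw [← Nat.div_mul_cancel (Nat.gcd_dvd_left b h)]
    push_cast
    rw [one_div_mul_one_div]; congr 1; ring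
  · intros; positivity

lemma rom_L3 (x h : ℕ) : (∑ a ∈ romU x, (1 : ℝ) / a) *
    (∑ a ∈ (romU x).filter (fun b => Nat.Coprime b h), (1 : ℝ) / a) ≤
    2 * ∑ t ∈ (romU x ×ˢ (romU x).filter (fun b => Nat.Coprime b h)).filter
      (fun t => Nat.Coprime t.1 t.2), (1 : ℝ) / (t.1 * t.2) := by
  rw [Finset.sum_mul_sum, ← Finset.sum_product']
  have h1 : ∑ t ∈ romU x ×ˢ (romU x).filter (fun b => Nat.Coprime b h), (1 : ℝ) / (t.1 : ℝ) * (1 / (t.2 : ℝ))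
      ≤ ∑ e ∈ (Finset.Icc 1 x) ×ˢ (romU x ×ˢ (romU x).filter (fun b => Nat.Coprime b h)).filter
      (fun t => Nat.Coprime t.1 t.2), (1 : ℝ) / (e.1 : ℝ) ^ 2 * (1 / (e.2.1 * e.2.2)) := by
    apply rom_inj _ _ (fun t => (Nat.gcd t.1 t.2, (t.1 / Nat.gcd t.1 t.2, t.2 / Nat.gcd t.1 t.2)))
    · rintro ⟨a, b⟩ hab
      simp only [Finset.mem_product, romU, Finset.mem_filter, Finset.mem_Icc] at hab ⊢
      obtain ⟨⟨⟨ha1, hax⟩, has⟩, ⟨⟨hb1, hbx⟩, hbs⟩, hbh⟩ := hab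
      have hga : Nat.gcd a b ∣ a := Nat.gcd_dvd_left _ _
      have hgb : Nat.gcd a b ∣ b := Nat.gcd_dvd_right _ _
      have hgpos : 0 < Nat.gcd a b := Nat.gcd_pos_of_pos_left _ ha1
      refine ⟨⟨hgpos, (Nat.le_of_dvd ha1 hga).trans hax⟩, ⟨⟨⟨?_, ?_⟩, ?_⟩, ⟨⟨?_, ?_⟩, ?_⟩, ?_⟩, ?_⟩
      · exact Nat.div_pos (Nat.le_of_dvd ha1 hga) hgpos
      · exact (Nat.div_le_self _ _).trans hax
      · exact has.squarefree_of_dvd (Nat.div_dvd_of_dvd hga)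
      · exact Nat.div_pos (Nat.le_of_dvd hb1 hgb) hgpos
      · exact (Nat.div_le_self _ _).trans hbx
      · exact hbs.squarefree_of_dvd (Nat.div_dvd_of_dvd hgb)
      · exact Nat.Coprime.coprime_dvd_left (Nat.div_dvd_of_dvd hgb) hbh
      · exact Nat.coprime_div_gcd_div_gcd hgpos
    · rintro ⟨a, b⟩ _ ⟨c, d⟩ _ hbc
      simp only [Prod.mk.injEq] at hbc ⊢
      refine ⟨?_, ?_⟩
      · rw [← Nat.div_mul_cancel (Nat.gcd_dvd_left a b), ← Nat.div_mul_cancel (Nat.gcd_dvd_left c d), hbc.2.1, hbc.1]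
      · rw [← Nat.div_mul_cancel (Nat.gcd_dvd_right a b), ← Nat.div_mul_cancel (Nat.gcd_dvd_right c d), hbc.2.2, hbc.1]
    · rintro ⟨a, b⟩ hab
      simp only
      apply le_of_eq
      have e1 : (a : ℝ) = ((a / Nat.gcd a b : ℕ) : ℝ) * (Nat.gcd a b : ℕ) := by
        exact_mod_cast (Nat.div_mul_cancel (Nat.gcd_dvd_left a b)).symm
      have e2 : (b : ℝ) = ((b / Nat.gcd a b : ℕ) : ℝ) * (Nat.gcd a b : ℕ) := by
        exact_mod_cast (Nat.div_mul_cancel (Nat.gcd_dvd_right a b)).symm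
      rw [one_div_mul_one_div, one_div_mul_one_div]
      congr 1
      calc (a : ℝ) * b = (((a / Nat.gcd a b : ℕ) : ℝ) * (Nat.gcd a b : ℕ)) * (((b / Nat.gcd a b : ℕ) : ℝ) * (Nat.gcd a b : ℕ)) := by
            rw [← e1, ← e2]
        _ = _ := by ring
    · intros; positivity
  rw [Finset.sum_product (s := Finset.Icc 1 x)] at h1
  simp_rw [← Finset.mul_sum] at h1
  rw [← Finset.sum_mul] at h1
  refine h1.trans ?_
  gcongr
  exact rom_sum_inv_sq x

lemma rom_sq_dvd_primorial (l z : ℕ) (hl : Squarefree l) (hlz : l ≤ z) : l ∣ primorial z := by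
  rw [← Nat.prod_primeFactors_of_squarefree hl]
  unfold primorial
  apply Finset.prod_dvd_prod_of_subset
  intro p hp
  rw [Nat.mem_primeFactors] at hp
  rw [Finset.mem_filter, Finset.mem_range]
  have := Nat.le_of_dvd (Nat.pos_of_ne_zero hp.2.2) hp.2.1
  exact ⟨by omega, hp.1⟩

lemma rom_L4 (x h : ℕ) (g : ℕ → ℝ) (D : Finset ℕ)
    (hD : ∀ l, Squarefree l → l ≤ x ^ 2 → l ∈ D) (hg0 : ∀ l ∈ D, 0 ≤ g l)
    (hg : ∀ l ∈ D, romNu h l ≤ g l) :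
    ∑ t ∈ (romU x ×ˢ (romU x).filter (fun b => Nat.Coprime b h)).filter
      (fun t => Nat.Coprime t.1 t.2), (1 : ℝ) / (t.1 * t.2) ≤ ∑ l ∈ D, g l := by
  calc _ ≤ ∑ t ∈ D.sigma (fun l => l.divisors.filter (fun b => Nat.Coprime b h)), (1 : ℝ) / t.1 := by
        apply rom_inj _ _ (fun t => ⟨t.1 * t.2, t.2⟩)
        · rintro ⟨a, b⟩ hab
          simp only [Finset.mem_product, romU, Finset.mem_filter, Finset.mem_Icc] at hab
          obtain ⟨⟨⟨⟨ha1, hax⟩, has⟩, ⟨⟨hb1, hbx⟩, hbs⟩, hbh⟩, hc⟩ := hab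
          simp only [Finset.mem_sigma, Finset.mem_filter, Nat.mem_divisors]
          refine ⟨hD _ ((Nat.squarefree_mul hc).2 ⟨has, hbs⟩) ?_, ⟨Dvd.intro_left _ rfl, by positivity⟩, hbh⟩
          nlinarith
        · rintro ⟨a, b⟩ hab ⟨c, d⟩ _ h
          simp only [Finset.mem_product, romU, Finset.mem_filter, Finset.mem_Icc, Finset.coe_filter, Set.mem_ofPred_eq] at hab
          simp only [Sigma.mk.injEq, heq_eq_eq] at h
          obtain ⟨h1, rfl⟩ := h
          have hb : 0 < b := hab.1.2.1.1.1
          rw [Nat.eq_of_mul_eq_mul_right hb h1]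
        · rintro ⟨a, b⟩ _
          simp
        · intros; positivity
    _ = ∑ l ∈ D, romNu h l := by
        rw [Finset.sum_sigma]
        apply Finset.sum_congr rfl
        intro l _
        rw [romNu_apply, romOm_apply]; simp [div_eq_mul_inv]
    _ ≤ _ := Finset.sum_le_sum hg

lemma rom_harm (x : ℕ) : Real.log x ≤ ∑ n ∈ Finset.Icc 1 x, (1 : ℝ) / n := by
  rcases Nat.eq_zero_or_pos x with h | h
  · simp [h]
  have := log_add_one_le_harmonic x
  rw [harmonic_eq_sum_Icc] at this
  push_cast at this
  have h2 : Real.log x ≤ Real.log (x + 1 : ℕ) := Real.log_le_log (by exact_mod_cast h) (by push_cast; linarith)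
  push_cast at h2
  simp only [one_div]
  linarith

lemma rom_S_lower (x h : ℕ) (hx : 1 ≤ x) (hh : h ≠ 0) (g : ℕ → ℝ) (D : Finset ℕ)
    (hD : ∀ l, Squarefree l → l ≤ x ^ 2 → l ∈ D) (hg0 : ∀ l ∈ D, 0 ≤ g l)
    (hg : ∀ l ∈ D, romNu h l ≤ g l) :
    (Real.log x) ^ 2 ≤ 8 * romF h * ∑ l ∈ D, g l := by
  have h1 := rom_L1 x
  have h2 := rom_L2 x h hh
  have h3 := rom_L3 x h
  have h4 := rom_L4 x h g D hD hg0 hg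
  have h5 := rom_harm x
  have hl : 0 ≤ Real.log x := Real.log_natCast_nonneg x
  have hF : 0 ≤ romF h := Finset.sum_nonneg (by intros; positivity)
  set Q := ∑ a ∈ romU x, (1 : ℝ) / a with hQ
  set Q' := ∑ a ∈ (romU x).filter (fun b => Nat.Coprime b h), (1 : ℝ) / a
  have hQ0 : 0 ≤ Q := Finset.sum_nonneg (by intros; positivity)
  calc (Real.log x) ^ 2 ≤ (2 * Q) ^ 2 := by gcongr; linarith
    _ = 4 * (Q * Q) := by ring
    _ ≤ 4 * (Q * (romF h * Q')) := by gcongr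
    _ = 4 * romF h * (Q * Q') := by ring
    _ ≤ 4 * romF h * (2 * ∑ l ∈ D, g l) :=
        mul_le_mul_of_nonneg_left (by linarith) (by positivity)
    _ = _ := by ring

end

section
open Finset

lemma rom_nu_lt_one (h p : ℕ) (hp : p.Prime) (he : 2 ∣ h) : romNu h p < 1 := by
  have hpp : (0 : ℝ) < p := by exact_mod_cast hp.pos
  rw [romNu_apply, div_lt_one hpp, romOm_apply]
  norm_cast
  by_cases h2 : p = 2
  · subst h2
    rw [Nat.Prime.divisors Nat.prime_two, Finset.filter_insert, Finset.filter_singleton]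
    have : ¬ Nat.Coprime 2 h := by
      rw [Nat.Prime.coprime_iff_not_dvd Nat.prime_two]; exact not_not.2 he
    simp [this]
  · have h3 : 3 ≤ p := by have := hp.two_le; omega
    refine lt_of_le_of_lt (Finset.card_filter_le _ _) ?_
    rw [Nat.Prime.divisors hp]
    exact lt_of_le_of_lt Finset.card_le_two (by omega)

lemma rom_primorial_sqf (z : ℕ) : Squarefree (primorial z) := by
  unfold primorial
  apply Finset.squarefree_prod_of_pairwise_isCoprime
  · intro p hp q hq hpq
    simp only [Finset.coe_filter, Finset.mem_range, Set.mem_ofPred_eq] at hp hq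
    show IsRelPrime p q
    rw [← Nat.coprime_iff_isRelPrime]
    exact (Nat.coprime_primes hp.2 hq.2).2 hpq
  · intro p hp
    exact (Finset.mem_filter.1 hp).2.prime.squarefree

/-- the sieve for n(n+h) -/
noncomputable def romSieve (N h z : ℕ) (he : 2 ∣ h) : BoundingSieve where
  support := (Finset.Ioc 0 N).image (fun n => n * (n + h))
  prodPrimes := primorial z
  prodPrimes_squarefree := rom_primorial_sqf z
  weights := fun _ => 1
  weights_nonneg := fun _ => zero_le_one
  totalMass := N
  nu := romNu h
  nu_mult := romNu_mult h
  nu_pos_of_prime := by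
    intro p hp _
    rw [romNu_apply]
    have := romOm_one_le h p hp.ne_zero
    have hpp : (0 : ℝ) < p := by exact_mod_cast hp.pos
    positivity
  nu_lt_one_of_prime := fun p hp _ => rom_nu_lt_one h p hp he

lemma rom_img_inj (N h : ℕ) : Set.InjOn (fun n => n * (n + h)) (Finset.Ioc 0 N : Set ℕ) := by
  intro a _ b _ hab
  simp only at hab
  rcases lt_trichotomy a b with h1 | h1 | h1
  · nlinarith
  · exact h1
  · nlinarith

lemma rom_rem (N h z d : ℕ) (he : 2 ∣ h) (hd : Squarefree d) :
    |(romSieve N h z he).rem d| ≤ d := by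
  refine le_trans ?_ (romOm_le h d)
  have := rom_count N h d hd
  unfold BoundingSieve.rem BoundingSieve.multSum romSieve
  simp only
  rw [Finset.sum_image (rom_img_inj N h), ← Finset.sum_filter]
  simp only [Finset.sum_const, nsmul_eq_mul, mul_one]
  rw [mul_comm (romNu h d)]
  exact this

lemma rom_romF_one_le (h : ℕ) (hh : h ≠ 0) : 1 ≤ romF h := by
  unfold romF
  calc (1 : ℝ) = ∑ m ∈ ({1} : Finset ℕ), (1 : ℝ) / m := by simp
    _ ≤ _ := by
        apply Finset.sum_le_sum_of_subset_of_nonneg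
        · intro m hm
          rw [Finset.mem_singleton] at hm
          subst hm
          simp [hh]
        · intros; positivity

lemma rom_pairs_even (N h x : ℕ) (hh : h ≠ 0) (he : 2 ∣ h) (hx : 2 ≤ x) :
    (#((Finset.Ioc 0 N).filter (fun n => n.Prime ∧ (n + h).Prime)) : ℝ) ≤
      8 * N * romF h / (Real.log x) ^ 2 + (x : ℝ) ^ 12 + (x : ℝ) ^ 2 := by
  set z := x ^ 2 with hz
  have hz1 : 1 ≤ z := Nat.one_le_pow _ _ (by omega)
  set s := romSieve N h z he with hs
  have hsel := rom_selberg s z hz1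
  set D := s.prodPrimes.divisors.filter (· ≤ z) with hD
  have hprod : s.prodPrimes = primorial z := rfl
  have hDm : ∀ l ∈ D, l ∣ s.prodPrimes ∧ l ≤ z ∧ 1 ≤ l ∧ Squarefree l := by
    intro l hl
    rw [hD, Finset.mem_filter, Nat.mem_divisors] at hl
    have hsq : Squarefree l := (rom_primorial_sqf z).squarefree_of_dvd hl.1.1
    exact ⟨hl.1.1, hl.2, Nat.pos_of_ne_zero hsq.ne_zero, hsq⟩
  have hSlow : (Real.log x) ^ 2 ≤ 8 * romF h * ∑ l ∈ D, s.selbergTerms l := by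
    apply rom_S_lower x h (by omega) hh
    · intro l hl hlx
      rw [hD, Finset.mem_filter, Nat.mem_divisors]
      exact ⟨⟨rom_sq_dvd_primorial l z hl hlx, BoundingSieve.prodPrimes_ne_zero⟩, hlx⟩
    · intro l hl
      exact (BoundingSieve.selbergTerms_pos (hDm l hl).1).le
    · intro l hl
      rw [BoundingSieve.selbergTerms_apply]
      have h0 : 0 < s.nu l := BoundingSieve.nu_pos_of_dvd_prodPrimes (hDm l hl).1
      have h1 : 1 ≤ ∏ p ∈ l.primeFactors, (1 - s.nu p)⁻¹ := by
        apply Finset.one_le_prod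
        · intro p hp
          have hp1 : p.Prime := Nat.prime_of_mem_primeFactors hp
          have hp2 : p ∣ s.prodPrimes := (Nat.dvd_of_mem_primeFactors hp).trans (hDm l hl).1
          have := s.nu_pos_of_prime p hp1 hp2
          have := s.nu_lt_one_of_prime p hp1 hp2
          rw [one_le_inv₀] <;> linarith
      show s.nu l ≤ _
      nlinarith
  have hlog : 0 < Real.log x := Real.log_pos (by exact_mod_cast hx)
  have hF := rom_romF_one_le h hh
  set S := ∑ l ∈ D, s.selbergTerms l with hSdef
  have hSpos : 0 < S := by
    by_contra hc
    push Not at hc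
    have : 0 < (Real.log x) ^ 2 := by positivity
    nlinarith
  have hmain : s.totalMass * S⁻¹ ≤ 8 * N * romF h / (Real.log x) ^ 2 := by
    show (N : ℝ) * S⁻¹ ≤ _
    rw [← div_eq_mul_inv, div_le_div_iff₀ hSpos (by positivity)]
    have hN : (0 : ℝ) ≤ N := by positivity
    nlinarith
  have herr : ∑ d1 ∈ D, ∑ d2 ∈ D, (s.nu d1)⁻¹ * (s.nu d2)⁻¹ * |s.rem (d1.lcm d2)| ≤ (x : ℝ) ^ 12 := by
    have hnuinv : ∀ d ∈ D, (s.nu d)⁻¹ ≤ z := by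
      intro d hd
      obtain ⟨h1, h2, h3, h4⟩ := hDm d hd
      show (romNu h d)⁻¹ ≤ z
      rw [romNu_apply, inv_div]
      have h5 := romOm_one_le h d h4.ne_zero
      have h6 : (d : ℝ) / romOm h d ≤ d := div_le_self (by positivity) h5
      have h7 : (d : ℝ) ≤ z := by exact_mod_cast h2
      linarith
    have hnupos : ∀ d ∈ D, 0 ≤ (s.nu d)⁻¹ := fun d hd =>
      inv_nonneg.2 (BoundingSieve.nu_pos_of_dvd_prodPrimes (hDm d hd).1).le
    have hcard : (#D : ℝ) ≤ z := by
      have : D ⊆ Finset.Icc 1 z := fun l hl => Finset.mem_Icc.2 ⟨(hDm l hl).2.2.1, (hDm l hl).2.1⟩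
      have := Finset.card_le_card this
      simp at this
      exact_mod_cast this
    calc _ ≤ ∑ d1 ∈ D, ∑ d2 ∈ D, (z : ℝ) * z * (z * z) := by
          apply Finset.sum_le_sum; intro d1 h1
          apply Finset.sum_le_sum; intro d2 h2
          have hl : d1.lcm d2 ∣ s.prodPrimes := Nat.lcm_dvd (hDm d1 h1).1 (hDm d2 h2).1
          have hr := rom_rem N h z (d1.lcm d2) he ((rom_primorial_sqf z).squarefree_of_dvd hl)
          have hlz : d1.lcm d2 ≤ z * z :=
            (Nat.le_of_dvd (Nat.mul_pos (hDm d1 h1).2.2.1 (hDm d2 h2).2.2.1) (Nat.lcm_dvd_mul d1 d2)).trans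
              (Nat.mul_le_mul (hDm d1 h1).2.1 (hDm d2 h2).2.1)
          have hlz' : ((d1.lcm d2 : ℕ) : ℝ) ≤ z * z := by exact_mod_cast hlz
          have a1 := hnuinv d1 h1
          have a2 := hnuinv d2 h2
          have a3 := hnupos d1 h1
          have a4 := hnupos d2 h2
          apply mul_le_mul (mul_le_mul a1 a2 a4 (by positivity)) (hr.trans hlz') (abs_nonneg _) (by positivity)
      _ = (#D : ℝ) * (#D) * ((z : ℝ) * z * (z * z)) := by simp; ring
      _ ≤ (z : ℝ) * z * ((z : ℝ) * z * (z * z)) := by gcongr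
      _ = (x : ℝ) ^ 12 := by rw [hz]; push_cast; ring
  have hsift : (#((Finset.Ioc 0 N).filter (fun n => n.Prime ∧ (n + h).Prime)) : ℝ) ≤ z + s.siftedSum := by
    have e1 : s.siftedSum = (#((Finset.Ioc 0 N).filter (fun n => Nat.Coprime (primorial z) (n * (n + h)))) : ℝ) := by
      unfold BoundingSieve.siftedSum
      rw [hs]
      unfold romSieve
      simp only
      rw [Finset.sum_image (rom_img_inj N h), ← Finset.sum_filter]
      simp
    rw [e1]
    have : (Finset.Ioc 0 N).filter (fun n => n.Prime ∧ (n + h).Prime) ⊆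
        Finset.Icc 1 z ∪ (Finset.Ioc 0 N).filter (fun n => Nat.Coprime (primorial z) (n * (n + h))) := by
      intro n hn
      rw [Finset.mem_filter, Finset.mem_Ioc] at hn
      rw [Finset.mem_union, Finset.mem_Icc, Finset.mem_filter, Finset.mem_Ioc]
      by_cases hnz : n ≤ z
      · left; exact ⟨hn.1.1, hnz⟩
      · right
        refine ⟨hn.1, ?_⟩
        have key : ∀ q : ℕ, q.Prime → z < q → Nat.Coprime (primorial z) q := by
          intro q hq hzq
          apply Nat.Coprime.symm
          rw [Nat.Prime.coprime_iff_not_dvd hq]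
          intro hd
          unfold primorial at hd
          rw [Prime.dvd_finsetProd_iff hq.prime] at hd
          obtain ⟨p, hp, hqp⟩ := hd
          rw [Finset.mem_filter, Finset.mem_range] at hp
          have := Nat.le_of_dvd hp.2.pos hqp
          omega
        exact Nat.Coprime.mul_right (key n hn.2.1 (by omega)) (key (n + h) hn.2.2 (by omega))
    have h1 := (Finset.card_le_card this).trans (Finset.card_union_le _ _)
    simp only [Nat.card_Icc, Nat.add_sub_cancel] at h1
    exact_mod_cast h1
  have : (z : ℝ) = (x : ℝ) ^ 2 := by rw [hz]; push_cast; ring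
  linarith

lemma rom_pairs (N h x : ℕ) (hh : h ≠ 0) (hx : 2 ≤ x) :
    (#((Finset.Ioc 0 N).filter (fun n => n.Prime ∧ (n + h).Prime)) : ℝ) ≤
      8 * N * romF h / (Real.log x) ^ 2 + (x : ℝ) ^ 12 + (x : ℝ) ^ 2 := by
  by_cases he : 2 ∣ h
  · exact rom_pairs_even N h x hh he hx
  · have hsub : (Finset.Ioc 0 N).filter (fun n => n.Prime ∧ (n + h).Prime) ⊆ {2} := by
      intro n hn
      rw [Finset.mem_filter, Finset.mem_Ioc] at hn
      rw [Finset.mem_singleton]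
      by_contra hc
      have h1 := hn.2.1.eq_two_or_odd
      have h2 := hn.2.2.eq_two_or_odd
      have := hn.2.1.two_le
      omega
    have h1 := Finset.card_le_card hsub
    rw [Finset.card_singleton] at h1
    have h2 : (#((Finset.Ioc 0 N).filter (fun n => n.Prime ∧ (n + h).Prime)) : ℝ) ≤ 1 := by exact_mod_cast h1
    have hF := rom_romF_one_le h hh
    have h3 : 0 ≤ 8 * N * romF h / (Real.log x) ^ 2 := by positivity
    have h4 : (0 : ℝ) ≤ (x : ℝ) ^ 12 := by positivity
    have h5 : (1 : ℝ) ≤ (x : ℝ) := by exact_mod_cast (by omega : 1 ≤ x)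
    have h6 : (1 : ℝ) ≤ (x : ℝ) ^ 2 := one_le_pow₀ h5
    linarith

end

section
open Finset

lemma rom_pairs_asymp : ∃ C : ℝ, 0 < C ∧ ∃ N0 : ℕ, ∀ N : ℕ, N0 ≤ N → ∀ h : ℕ, h ≠ 0 →
    (#((Finset.Ioc 0 N).filter (fun n => n.Prime ∧ (n + h).Prime)) : ℝ) ≤
      C * N / (Real.log N) ^ 2 * romF h := by
  refine ⟨8 * 48 ^ 2 + 32, by norm_num, 2 ^ 48, ?_⟩
  intro N hN h hh
  have hNr : (2 : ℝ) ^ 48 ≤ N := by exact_mod_cast hN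
  have hN0 : (0 : ℝ) < N := lt_of_lt_of_le (by positivity) hNr
  have hN1 : (1 : ℝ) ≤ N := le_trans (by norm_num) hNr
  set t : ℝ := (N : ℝ) ^ (1 / 48 : ℝ) with ht
  have ht48 : t ^ 48 = N := by
    rw [ht, ← Real.rpow_natCast, ← Real.rpow_mul hN0.le]; norm_num
  have ht0 : 0 < t := Real.rpow_pos_of_pos hN0 _
  have ht2 : 2 ≤ t := by
    by_contra hc
    push Not at hc
    have : t ^ 48 < 2 ^ 48 := pow_lt_pow_left₀ hc ht0.le (by norm_num)
    linarith
  set x := ⌊t ^ 2⌋₊ with hx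
  have hxle : (x : ℝ) ≤ t ^ 2 := Nat.floor_le (by positivity)
  have hxlt : t ^ 2 < x + 1 := Nat.lt_floor_add_one _
  have hxt : t ≤ x := by nlinarith
  have hx2 : 2 ≤ x := by
    have : (2 : ℝ) ≤ x := by linarith
    exact_mod_cast this
  have hlogt : Real.log N = 48 * Real.log t := by
    rw [← ht48, Real.log_pow]; norm_num
  have hlt : 0 < Real.log t := Real.log_pos (by linarith)
  have hlogx : Real.log t ≤ Real.log x := Real.log_le_log ht0 hxt
  have hF := rom_romF_one_le h hh
  have hmain := rom_pairs N h x hh hx2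
  have h1 : 8 * N * romF h / (Real.log x) ^ 2 ≤ (8 * 48 ^ 2) * N / (Real.log N) ^ 2 * romF h := by
    calc _ ≤ 8 * N * romF h / (Real.log t) ^ 2 := by gcongr
      _ = _ := by rw [hlogt]; field_simp
  have h2 : (x : ℝ) ^ 12 ≤ t ^ 24 := by
    calc (x : ℝ) ^ 12 ≤ (t ^ 2) ^ 12 := by gcongr
      _ = _ := by ring
  have h3 : (x : ℝ) ^ 2 ≤ t ^ 24 := by
    calc (x : ℝ) ^ 2 ≤ (t ^ 2) ^ 2 := by gcongr
      _ = t ^ 4 := by ring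
      _ ≤ t ^ 24 := pow_le_pow_right₀ (by linarith) (by norm_num)
  have h4 : t ^ 24 ≤ 16 * N / (Real.log N) ^ 2 := by
    have hl : Real.log N ≤ 4 * t ^ 12 := by
      have := Real.log_le_rpow_div hN0.le (show (0 : ℝ) < 1 / 4 by norm_num)
      have e : (N : ℝ) ^ (1 / 4 : ℝ) = t ^ 12 := by
        rw [ht, ← Real.rpow_natCast, ← Real.rpow_mul hN0.le]; norm_num
      rw [e] at this
      linarith
    have hl0 : 0 < Real.log N := by rw [hlogt]; linarith
    rw [le_div_iff₀ (by positivity)]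
    calc t ^ 24 * (Real.log N) ^ 2 ≤ t ^ 24 * (4 * t ^ 12) ^ 2 := by gcongr
      _ = 16 * t ^ 48 := by ring
      _ = 16 * N := by rw [ht48]
  have h5 : 16 * N / (Real.log N) ^ 2 ≤ 16 * N / (Real.log N) ^ 2 * romF h :=
    le_mul_of_one_le_right (by positivity) hF
  have h6 : (8 * 48 ^ 2 + 32) * N / (Real.log N) ^ 2 * romF h = (8 * 48 ^ 2) * N / (Real.log N) ^ 2 * romF h
     + 2 * (16 * N / (Real.log N) ^ 2 * romF h) := by ring
  rw [h6]
  linarith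

lemma rom_F_prod (h : ℕ) : romF h ≤ ∏ p ∈ h.primeFactors, (1 + (1 : ℝ) / p) := by
  rw [Finset.prod_one_add]
  unfold romF
  apply rom_inj _ _ Nat.primeFactors
  · intro m hm
    rw [Finset.mem_filter, Nat.mem_divisors] at hm
    rw [Finset.mem_powerset]
    exact Nat.primeFactors_mono hm.1.1 hm.1.2
  · intro m hm n hn hmn
    simp only [Finset.coe_filter, Set.mem_ofPred_eq] at hm hn
    rw [← Nat.prod_primeFactors_of_squarefree hm.2, ← Nat.prod_primeFactors_of_squarefree hn.2, hmn]
  · intro m hm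
    rw [Finset.mem_filter] at hm
    apply le_of_eq
    conv_lhs => rw [← Nat.prod_primeFactors_of_squarefree hm.2]
    push_cast
    simp
  · intros; positivity

/-- Mertens product -/
noncomputable def romG (n : ℕ) : ℝ := ∏ p ∈ (Finset.Icc 1 n).filter Nat.Prime, (1 + (1 : ℝ) / p)

lemma romG_succ_prime (n : ℕ) (hn : (n + 1).Prime) : romG (n + 1) = romG n * (1 + 1 / ((n + 1 : ℕ) : ℝ)) := by
  unfold romG
  rw [← Finset.insert_Icc_right_eq_Icc_add_one (by omega), Finset.filter_insert, if_pos hn, Finset.prod_insert (by simp), mul_comm]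

lemma romG_succ_not (n : ℕ) (hn : ¬ (n + 1).Prime) : romG (n + 1) = romG n := by
  unfold romG
  rw [← Finset.insert_Icc_right_eq_Icc_add_one (by omega), Finset.filter_insert, if_neg hn]

lemma romG_pos (n : ℕ) : 0 < romG n := Finset.prod_pos (by intros; positivity)

lemma romG_succ_le (n : ℕ) : romG (n + 1) ≤ romG n * (1 + 1 / ((n + 1 : ℕ) : ℝ)) := by
  by_cases hn : (n + 1).Prime
  · exact (romG_succ_prime n hn).le
  · rw [romG_succ_not n hn]
    have := romG_pos n
    apply le_mul_of_one_le_right this.le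
    have : (0 : ℝ) ≤ 1 / ((n + 1 : ℕ) : ℝ) := by positivity
    linarith

lemma romG_mono : Monotone romG := by
  apply monotone_nat_of_le_succ
  intro n
  by_cases hn : (n + 1).Prime
  · rw [romG_succ_prime n hn]
    have := romG_pos n
    apply le_mul_of_one_le_right this.le
    have : (0 : ℝ) ≤ 1 / ((n + 1 : ℕ) : ℝ) := by positivity
    linarith
  · rw [romG_succ_not n hn]

lemma romG_odd (m : ℕ) : romG (2 * m + 3) ^ 2 ≤ 4 * (m + 1) := by
  induction m with
  | zero =>
    have h3 : romG 3 = 2 := by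
      rw [romG_succ_prime 2 (by norm_num), romG_succ_prime 1 (by norm_num), romG_succ_not 0 (by norm_num)]
      simp [romG]; norm_num
    simp [h3]; norm_num
  | succ m ih =>
    have e : 2 * (m + 1) + 3 = (2 * m + 3 + 1) + 1 := by ring
    rw [e]
    have h1 := romG_succ_le (2 * m + 3 + 1)
    rw [romG_succ_not (2 * m + 3) (by
      intro hp
      have := hp.eq_two_or_odd
      omega)] at h1
    have h0 := romG_pos (2 * m + 3 + 1 + 1)
    have hm : (0 : ℝ) ≤ m := by positivity
    calc romG (2 * m + 3 + 1 + 1) ^ 2 ≤ (romG (2 * m + 3) * (1 + 1 / ((2 * m + 3 + 1 + 1 : ℕ) : ℝ))) ^ 2 := by gcongr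
      _ = romG (2 * m + 3) ^ 2 * (1 + 1 / ((2 * m + 3 + 1 + 1 : ℕ) : ℝ)) ^ 2 := by ring
      _ ≤ 4 * (m + 1) * (1 + 1 / ((2 * m + 3 + 1 + 1 : ℕ) : ℝ)) ^ 2 := by gcongr
      _ ≤ 4 * ((m + 1 : ℕ) + 1) := by
        push_cast
        have e2 : (1 + 1 / ((2 : ℝ) * m + 3 + 1 + 1)) = (2 * m + 6) / (2 * m + 5) := by field_simp; ring
        rw [e2, div_pow, ← mul_div_assoc, div_le_iff₀ (by positivity)]
        nlinarith

lemma romG_le (n : ℕ) : romG n ≤ 2 * Real.sqrt (n + 1 : ℝ) := by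
  have h1 : romG n ≤ romG (2 * (n / 2) + 3) := romG_mono (by omega)
  have h2 := romG_odd (n / 2)
  have h3 := romG_pos n
  have h4 : ((n / 2 : ℕ) : ℝ) ≤ n := by exact_mod_cast Nat.div_le_self n 2
  have h5 : romG n ^ 2 ≤ 4 * (n + 1 : ℝ) := by nlinarith
  apply le_of_sq_le_sq ?_ (by positivity)
  rw [mul_pow, Real.sq_sqrt (by positivity)]
  linarith

lemma rom_F_small (h B : ℕ) : ∏ p ∈ h.primeFactors.filter (· ≤ B), (1 + (1 : ℝ) / p) ≤
    1 + 2 * ∑ q ∈ (Finset.Icc 1 B).filter (· ∣ h), 1 / Real.sqrt q := by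
  induction B with
  | zero =>
    have : h.primeFactors.filter (· ≤ 0) = ∅ := by
      apply Finset.filter_eq_empty_iff.2
      intro p hp
      have := (Nat.prime_of_mem_primeFactors hp).pos
      omega
    rw [this]; simp
  | succ B ih =>
    have hs : ∑ q ∈ (Finset.Icc 1 (B + 1)).filter (· ∣ h), 1 / Real.sqrt q =
        (if (B + 1) ∣ h then 1 / Real.sqrt ((B + 1 : ℕ) : ℝ) else 0) + ∑ q ∈ (Finset.Icc 1 B).filter (· ∣ h), 1 / Real.sqrt q := by
      rw [← Finset.insert_Icc_right_eq_Icc_add_one (by omega), Finset.filter_insert]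
      split_ifs with hd
      · rw [Finset.sum_insert (by simp)]
      · simp
    rw [hs]
    by_cases hB : B + 1 ∈ h.primeFactors
    · have e : h.primeFactors.filter (· ≤ B + 1) = insert (B + 1) (h.primeFactors.filter (· ≤ B)) := by
        ext p
        simp only [Finset.mem_filter, Finset.mem_insert]
        constructor
        · rintro ⟨h1, h2⟩
          by_cases h3 : p = B + 1
          · left; exact h3
          · right; exact ⟨h1, by omega⟩
        · rintro (h1 | ⟨h1, h2⟩)
          · rw [h1]; exact ⟨hB, le_refl _⟩
          · exact ⟨h1, by omega⟩
      rw [e, Finset.prod_insert (by simp), if_pos (Nat.dvd_of_mem_primeFactors hB)]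
      have hG : ∏ p ∈ h.primeFactors.filter (· ≤ B), (1 + (1 : ℝ) / p) ≤ romG B := by
        unfold romG
        apply Finset.prod_le_prod_of_subset_of_one_le
        · intro p hp
          rw [Finset.mem_filter] at hp
          have := Nat.prime_of_mem_primeFactors hp.1
          rw [Finset.mem_filter, Finset.mem_Icc]
          exact ⟨⟨this.pos, hp.2⟩, this⟩
        · intros; positivity
        · intro p _ _
          have : (0 : ℝ) ≤ 1 / (p : ℝ) := by positivity
          linarith
      have hG2 := hG.trans (romG_le B)
      set P := ∏ p ∈ h.primeFactors.filter (· ≤ B), (1 + (1 : ℝ) / p)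
      have hsq : Real.sqrt ((B + 1 : ℕ) : ℝ) * Real.sqrt ((B + 1 : ℕ) : ℝ) = ((B + 1 : ℕ) : ℝ) := Real.mul_self_sqrt (by positivity)
      have hsp : 0 < Real.sqrt ((B + 1 : ℕ) : ℝ) := Real.sqrt_pos.2 (by positivity)
      have hk : P * (1 / ((B + 1 : ℕ) : ℝ)) ≤ 2 * (1 / Real.sqrt ((B + 1 : ℕ) : ℝ)) := by
        have hG3 : P ≤ 2 * Real.sqrt ((B + 1 : ℕ) : ℝ) := by push_cast; exact hG2
        rw [mul_one_div, mul_one_div, div_le_div_iff₀ (by positivity) hsp]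
        nlinarith
      linarith
    · have e : h.primeFactors.filter (· ≤ B + 1) = h.primeFactors.filter (· ≤ B) := by
        apply Finset.filter_congr
        intro p hp
        constructor
        · intro h1
          by_contra h2
          have : p = B + 1 := by omega
          rw [this] at hp; exact hB hp
        · intro h1; omega
      rw [e]
      have : (0 : ℝ) ≤ (if (B + 1) ∣ h then 1 / Real.sqrt ((B + 1 : ℕ) : ℝ) else 0) := by
        split_ifs <;> positivity
      linarith

lemma rom_F_bound (h B : ℕ) (hh : h ≠ 0) (hB : 1 ≤ B) (hhB : h ≤ 2 ^ B) : romF h ≤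
    3 * (1 + 2 * ∑ q ∈ (Finset.Icc 1 B).filter (· ∣ h), 1 / Real.sqrt q) := by
  refine (rom_F_prod h).trans ?_
  rw [← Finset.prod_filter_mul_prod_filter_not h.primeFactors (· ≤ B)]
  have h1 := rom_F_small h B
  have hcard : #(h.primeFactors) ≤ B := by
    have : 2 ^ #(h.primeFactors) ≤ 2 ^ B := by
      calc 2 ^ #(h.primeFactors) = ∏ p ∈ h.primeFactors, 2 := by simp
        _ ≤ ∏ p ∈ h.primeFactors, p := Finset.prod_le_prod' (fun p hp => (Nat.prime_of_mem_primeFactors hp).two_le)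
        _ ≤ h := Nat.le_of_dvd (Nat.pos_of_ne_zero hh) (Nat.prod_primeFactors_dvd h)
        _ ≤ _ := hhB
    exact (Nat.pow_le_pow_iff_right (by norm_num)).1 this
  have hB0 : (0 : ℝ) < B := by exact_mod_cast hB
  have h2 : ∏ p ∈ h.primeFactors.filter (fun p => ¬ p ≤ B), (1 + (1 : ℝ) / p) ≤ 3 := by
    calc _ ≤ ∏ p ∈ h.primeFactors.filter (fun p => ¬ p ≤ B), Real.exp (1 / B) := by
          apply Finset.prod_le_prod
          · intros; positivity
          · intro p hp
            rw [Finset.mem_filter] at hp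
            have hpB : (B : ℝ) ≤ p := by exact_mod_cast (by omega : B ≤ p)
            have := Real.add_one_le_exp (1 / B : ℝ)
            have : 1 / (p : ℝ) ≤ 1 / B := one_div_le_one_div_of_le hB0 hpB
            linarith
      _ = Real.exp (1 / B) ^ #(h.primeFactors.filter (fun p => ¬ p ≤ B)) := by simp
      _ ≤ Real.exp (1 / B) ^ B := pow_le_pow_right₀ (Real.one_le_exp (by positivity)) ((Finset.card_filter_le _ _).trans hcard)
      _ = Real.exp 1 := by rw [← Real.exp_nat_mul]; congr 1; field_simp
      _ ≤ 3 := by have := Real.exp_one_lt_d9; linarith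
  have h3 : 0 ≤ ∏ p ∈ h.primeFactors.filter (· ≤ B), (1 + (1 : ℝ) / p) := Finset.prod_nonneg (by intros; positivity)
  have h4 : 0 ≤ ∏ p ∈ h.primeFactors.filter (fun p => ¬ p ≤ B), (1 + (1 : ℝ) / p) := Finset.prod_nonneg (by intros; positivity)
  nlinarith

end

section
open Finset

lemma rom_pow_upper (k : ℕ) (s t : ℝ) (hs : 0 ≤ s) (hst : s ≤ t) :
    t ^ (k + 1) - s ^ (k + 1) ≤ (k + 1) * t ^ k * (t - s) := by
  induction k with
  | zero => simp
  | succ k ih =>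
    have h1 : s ^ (k + 1) ≤ t ^ (k + 1) := pow_le_pow_left₀ hs hst _
    have h2 : t * (t ^ (k + 1) - s ^ (k + 1)) ≤ t * ((k + 1) * t ^ k * (t - s)) :=
      mul_le_mul_of_nonneg_left ih (hs.trans hst)
    have h3 : s ^ (k + 1) * (t - s) ≤ t ^ (k + 1) * (t - s) := mul_le_mul_of_nonneg_right h1 (by linarith)
    have e : t ^ (k + 1 + 1) - s ^ (k + 1 + 1) = t * (t ^ (k + 1) - s ^ (k + 1)) + s ^ (k + 1) * (t - s) := by ring
    have e2 : ((k + 1 : ℕ) + 1 : ℝ) * t ^ (k + 1) * (t - s) = t * ((k + 1) * t ^ k * (t - s)) + t ^ (k + 1) * (t - s) := by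
      push_cast; ring
    rw [e, e2]; linarith

lemma rom_pow_lower (k : ℕ) (s t : ℝ) (hs : 0 ≤ s) (hst : s ≤ t) :
    (k + 1) * s ^ k * (t - s) ≤ t ^ (k + 1) - s ^ (k + 1) := by
  induction k with
  | zero => simp
  | succ k ih =>
    have h0 : s ^ k ≤ t ^ k := pow_le_pow_left₀ hs hst _
    have h2 : s * ((k + 1) * s ^ k * (t - s)) ≤ s * (t ^ (k + 1) - s ^ (k + 1)) :=
      mul_le_mul_of_nonneg_left ih hs
    have h3 : s ^ (k + 1) * (t - s) ≤ t ^ (k + 1) * (t - s) :=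
      mul_le_mul_of_nonneg_right (pow_le_pow_left₀ hs hst _) (by linarith)
    have e : t ^ (k + 1 + 1) - s ^ (k + 1 + 1) = s * (t ^ (k + 1) - s ^ (k + 1)) + t ^ (k + 1) * (t - s) := by ring
    have e2 : ((k + 1 : ℕ) + 1 : ℝ) * s ^ (k + 1) * (t - s) = s * ((k + 1) * s ^ k * (t - s)) + s ^ (k + 1) * (t - s) := by
      push_cast; ring
    rw [e, e2]; linarith

/-- k-th root -/
noncomputable def romR (k n : ℕ) : ℝ := (n : ℝ) ^ (1 / (k : ℝ))

lemma romR_nonneg (k n : ℕ) : 0 ≤ romR k n := by unfold romR; positivity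

lemma romR_pow (k n : ℕ) (hk : k ≠ 0) : romR k n ^ k = n := by
  unfold romR
  rw [one_div]
  exact Real.rpow_inv_natCast_pow (by positivity) hk

lemma romR_mono (k : ℕ) : Monotone (romR k) := by
  intro m n h
  unfold romR
  exact Real.rpow_le_rpow (by positivity) (by exact_mod_cast h) (by positivity)

lemma romR_le_iff (k n : ℕ) (hk : k ≠ 0) (y : ℝ) (hy : 0 ≤ y) : romR k n ≤ y ↔ (n : ℝ) ≤ y ^ k := by
  rw [← romR_pow k n hk]
  exact (pow_le_pow_iff_left₀ (romR_nonneg k n) hy hk).symm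

lemma romR_floor (k n : ℕ) (hk : k ≠ 0) (y : ℝ) (hy : 0 ≤ y) :
    y ∈ Set.Ico (romR k n) (romR k (n + 1)) ↔ ⌊y ^ k⌋₊ = n := by
  rw [Set.mem_Ico, romR_le_iff k n hk y hy, ← not_le, romR_le_iff k (n + 1) hk y hy, Nat.floor_eq_iff (by positivity)]
  push_cast
  rw [not_le]

lemma romR_diff_upper (k n : ℕ) : (k + 1) * romR (k + 1) n ^ k * (romR (k + 1) (n + 1) - romR (k + 1) n) ≤ 1 := by
  have := rom_pow_lower k (romR (k + 1) n) (romR (k + 1) (n + 1)) (romR_nonneg _ _) (romR_mono _ (by omega))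
  rw [romR_pow _ _ (by omega), romR_pow _ _ (by omega)] at this
  push_cast at this
  linarith

lemma romR_diff_lower (k n : ℕ) : 1 ≤ (k + 1) * romR (k + 1) (n + 1) ^ k * (romR (k + 1) (n + 1) - romR (k + 1) n) := by
  have := rom_pow_upper k (romR (k + 1) n) (romR (k + 1) (n + 1)) (romR_nonneg _ _) (romR_mono _ (by omega))
  rw [romR_pow _ _ (by omega), romR_pow _ _ (by omega)] at this
  push_cast at this
  linarith

/-- length of the interval -/
noncomputable def romL (k n : ℕ) : ℝ := romR k (n + 1) - romR k n

lemma romL_nonneg (k n : ℕ) : 0 ≤ romL k n := sub_nonneg.2 (romR_mono k (by omega))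

lemma romL_anti (k i n : ℕ) (hk : k ≠ 0) (hin : i < n) : romL k n ≤ romL k i := by
  obtain ⟨k, rfl⟩ := Nat.exists_eq_succ_of_ne_zero hk
  have h1 := romR_diff_upper k n
  have h2 := romR_diff_lower k i
  have h3 : romR (k + 1) (i + 1) ^ k ≤ romR (k + 1) n ^ k :=
    pow_le_pow_left₀ (romR_nonneg _ _) (romR_mono _ (by omega)) _
  have h4 := romL_nonneg (k + 1) n
  have h5 := romL_nonneg (k + 1) i
  simp only [Nat.succ_eq_add_one]
  change _ * romL (k + 1) n ≤ 1 at h1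
  change 1 ≤ _ * romL (k + 1) i at h2
  have hk0 : (0 : ℝ) ≤ (k : ℝ) + 1 := by positivity
  set A := (k + 1 : ℝ) * romR (k + 1) (i + 1) ^ k
  set B := (k + 1 : ℝ) * romR (k + 1) n ^ k
  have hAB : A ≤ B := mul_le_mul_of_nonneg_left h3 hk0
  have hA : 0 < A := by
    by_contra hc
    push Not at hc
    nlinarith
  by_contra hc
  push Not at hc
  nlinarith

/-- admissible intervals -/
def romAdm (q κ : ℕ) (u v : ℝ) : Prop :=
  1 ≤ u ∧ u < v ∧ ∀ k : ℕ, κ ≤ k → 2 ≤ u ^ k ∧ (q : ℝ) ≤ k * u ^ (k - 1) * (v - u)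

lemma romAdm_mono (q κ κ' : ℕ) (u v : ℝ) (h : romAdm q κ u v) (hk : κ ≤ κ') : romAdm q κ' u v :=
  ⟨h.1, h.2.1, fun k hk' => h.2.2 k (hk.trans hk')⟩

lemma rom_lemA_far (q c k : ℕ) (hq : 1 ≤ q) (hk : k ≠ 0) (u v : ℝ) (hu : 0 ≤ u) (huv : u < v)
    (T : Finset ℕ) (hT : ∀ n ∈ T, n % q = c ∧ u ^ k + q ≤ n ∧ (n : ℝ) < v ^ k) :
    ∑ n ∈ T, romL k n ≤ 1 / q * (v - u) := by
  have hq0 : (0 : ℝ) < q := by exact_mod_cast hq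
  rcases T.eq_empty_or_nonempty with h | h
  · subst h
    simp only [Finset.sum_empty]
    have : 0 < v - u := by linarith
    positivity
  have hqn : ∀ n ∈ T, ⌈u ^ k⌉₊ + q ≤ n := by
    intro n hn
    have h1 := (hT n hn).2.1
    have h2 : ⌈u ^ k + q⌉₊ ≤ n := Nat.ceil_le.2 h1
    rwa [Nat.ceil_add_natCast (by positivity)] at h2
  set L := ⌈u ^ k⌉₊ with hL
  set M := ⌈v ^ k⌉₊ - 1 with hM
  have hMn : ∀ n ∈ T, n ≤ M := by
    intro n hn
    have h1 : n < ⌈v ^ k⌉₊ := Nat.lt_ceil.2 (hT n hn).2.2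
    omega
  have hMv : (M : ℝ) ≤ v ^ k := by
    obtain ⟨n, hn⟩ := h
    have h1 : n < ⌈v ^ k⌉₊ := Nat.lt_ceil.2 (hT n hn).2.2
    have : M < ⌈v ^ k⌉₊ := by omega
    exact (Nat.lt_ceil.1 this).le
  have key : (q : ℝ) * ∑ n ∈ T, romL k n ≤ v - u := by
    calc (q : ℝ) * ∑ n ∈ T, romL k n = ∑ n ∈ T, ∑ i ∈ Finset.Ico (n - q) n, romL k n := by
          rw [Finset.mul_sum]
          apply Finset.sum_congr rfl
          intro n hn
          have := hqn n hn
          rw [Finset.sum_const, Nat.card_Ico, nsmul_eq_mul]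
          congr 2
          omega
      _ ≤ ∑ n ∈ T, ∑ i ∈ Finset.Ico (n - q) n, romL k i := by
          apply Finset.sum_le_sum
          intro n hn
          apply Finset.sum_le_sum
          intro i hi
          exact romL_anti k i n hk (Finset.mem_Ico.1 hi).2
      _ = ∑ i ∈ T.biUnion (fun n => Finset.Ico (n - q) n), romL k i := by
          rw [Finset.sum_biUnion]
          intro n hn m hm hnm
          rw [Function.onFun, Finset.disjoint_left]
          intro i hi hi2
          rw [Finset.mem_Ico] at hi hi2
          apply hnm
          have h1 := (hT n hn).1
          have h2 := (hT m hm).1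
          have e : n ≡ m [MOD q] := h1.trans h2.symm
          rcases le_total n m with h3 | h3
          · exact Nat.ModEq.eq_of_abs_lt e (by rw [abs_lt]; constructor <;> omega)
          · exact Nat.ModEq.eq_of_abs_lt e (by rw [abs_lt]; constructor <;> omega)
      _ ≤ ∑ i ∈ Finset.Ico L M, romL k i := by
          apply Finset.sum_le_sum_of_subset_of_nonneg
          · intro i hi
            rw [Finset.mem_biUnion] at hi
            obtain ⟨n, hn, hi⟩ := hi
            rw [Finset.mem_Ico] at hi ⊢
            have := hqn n hn
            have := hMn n hn
            omega
          · intros; exact romL_nonneg _ _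
      _ = romR k M - romR k L := by
          unfold romL
          apply Finset.sum_Ico_sub
          obtain ⟨n, hn⟩ := h
          have := hqn n hn
          have := hMn n hn
          omega
      _ ≤ v - u := by
          have h1 : romR k M ≤ v := (romR_le_iff k M hk v (by linarith)).2 hMv
          have h2 : u ≤ romR k L := by
            rw [← pow_le_pow_iff_left₀ hu (romR_nonneg k L) hk, romR_pow k L hk]
            exact Nat.le_ceil _
          linarith
  rw [one_div, inv_mul_eq_div, le_div_iff₀ hq0]
  linarith

lemma rom_L_near (k n : ℕ) (u : ℝ) (hu : 1 ≤ u) (h2 : 2 ≤ u ^ (k + 1)) (hn : u ^ (k + 1) < n + 1) :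
    (k + 1) * u ^ k * romL (k + 1) n ≤ 2 := by
  have h1 := romR_diff_upper k n
  change _ * romL (k + 1) n ≤ 1 at h1
  have h3 := romL_nonneg (k + 1) n
  set s := romR (k + 1) n with hs
  have hs0 : 0 ≤ s := romR_nonneg _ _
  have hsp : s ^ (k + 1) = n := romR_pow _ _ (by omega)
  have hk : u ^ k ≤ 2 * s ^ k := by
    rcases le_total u s with h | h
    · have := pow_le_pow_left₀ (by linarith) h k
      have : 0 ≤ s ^ k := by positivity
      linarith
    · have e : u ^ (k + 1) ≤ 2 * s ^ (k + 1) := by rw [hsp]; linarith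
      rw [pow_succ, pow_succ] at e
      have h5 : 0 ≤ s ^ k := by positivity
      have h6 : u ^ k * u ≤ (2 * s ^ k) * u := by nlinarith
      exact le_of_mul_le_mul_right h6 (by linarith)
  have : (k + 1) * u ^ k * romL (k + 1) n ≤ (k + 1) * (2 * s ^ k) * romL (k + 1) n := by gcongr
  linarith

lemma rom_lemA (q c k : ℕ) (hq : 1 ≤ q) (hk : k ≠ 0) (u v : ℝ) (hA : romAdm q k u v)
    (T : Finset ℕ) (hT : ∀ n ∈ T, n % q = c ∧ u ^ k < n + 1 ∧ (n : ℝ) < v ^ k) :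
    ∑ n ∈ T, romL k n ≤ 5 / q * (v - u) := by
  have hq0 : (0 : ℝ) < q := by exact_mod_cast hq
  obtain ⟨hu, huv, hA⟩ := hA
  obtain ⟨hA1, hA2⟩ := hA k le_rfl
  rw [← Finset.sum_filter_add_sum_filter_not T (fun n => u ^ k + q ≤ (n : ℝ))]
  have h1 := rom_lemA_far q c k hq hk u v (by linarith) huv (T.filter (fun n => u ^ k + q ≤ (n : ℝ))) (by
    intro n hn
    rw [Finset.mem_filter] at hn
    exact ⟨(hT n hn.1).1, hn.2, (hT n hn.1).2.2⟩)
  obtain ⟨k, rfl⟩ := Nat.exists_eq_succ_of_ne_zero hk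
  simp only [Nat.succ_eq_add_one, Nat.add_sub_cancel] at *
  have h2 : ∀ n ∈ T.filter (fun n : ℕ => ¬ u ^ (k + 1) + q ≤ (n : ℝ)), romL (k + 1) n ≤ 2 / q * (v - u) := by
    intro n hn
    rw [Finset.mem_filter] at hn
    have h3 := rom_L_near k n u hu hA1 (hT n hn.1).2.1
    have hL := romL_nonneg (k + 1) n
    have huk : 0 < u ^ k := by positivity
    push_cast at hA2
    have h4 : q * romL (k + 1) n ≤ (k + 1) * u ^ k * (v - u) * romL (k + 1) n := by gcongr
    have h5 : (k + 1) * u ^ k * (v - u) * romL (k + 1) n ≤ 2 * (v - u) := by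
      have := mul_le_mul_of_nonneg_right h3 (by linarith : (0 : ℝ) ≤ v - u)
      linarith
    rw [div_mul_eq_mul_div, le_div_iff₀ hq0]
    linarith
  have h3 : #(T.filter (fun n : ℕ => ¬ u ^ (k + 1) + q ≤ (n : ℝ))) ≤ 2 := by
    by_contra hc
    rw [not_le] at hc
    obtain ⟨x, y, z, hx, hy, hz, hxy, hxz, hyz⟩ := Finset.two_lt_card_iff.1 hc
    have key : ∀ x y : ℕ, x ∈ T.filter (fun n : ℕ => ¬ u ^ (k + 1) + q ≤ (n : ℝ)) →
        y ∈ T.filter (fun n : ℕ => ¬ u ^ (k + 1) + q ≤ (n : ℝ)) → x < y → y = x + q := by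
      intro x y hx hy hxy
      rw [Finset.mem_filter] at hx hy
      have a1 := (hT x hx.1).2.1
      have a2 := hy.2
      push Not at a2
      have a3 : (y : ℝ) < x + 1 + q := by linarith
      have a4 : y < x + 1 + q := by exact_mod_cast a3
      by_contra hne
      have e : x ≡ y [MOD q] := (hT x hx.1).1.trans (hT y hy.1).1.symm
      have := Nat.ModEq.eq_of_abs_lt e (by rw [abs_lt]; constructor <;> omega)
      omega
    have k1 := key x y hx hy
    have k2 := key y x hy hx
    have k3 := key x z hx hz
    have k4 := key z x hz hx
    have k5 := key z y hz hy
    have k6 := key y z hy hz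
    omega
  have h4 := Finset.sum_le_card_nsmul _ _ _ h2
  rw [nsmul_eq_mul] at h4
  have h5 : (#(T.filter (fun n : ℕ => ¬ u ^ (k + 1) + q ≤ (n : ℝ))) : ℝ) ≤ 2 := by exact_mod_cast h3
  have h6 : 0 ≤ 2 / q * (v - u) := mul_nonneg (by positivity) (by linarith)
  have h7 : (5 : ℝ) / q * (v - u) = 1 / q * (v - u) + 2 * (2 / q * (v - u)) := by ring
  rw [h7]
  nlinarith

lemma rom_lemB (q κ g n : ℕ) (hq : 1 ≤ q) (w : ℝ) (hw : 1 < w) (hg : 2 * (q : ℝ) ≤ w ^ g) (hκ0 : κ ≠ 0) (hκ : g ≤ κ)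
    (hn : (w ^ 2) ^ κ < n + 1) : romAdm q (κ + g) (romR κ n) (romR κ (n + 1)) := by
  have hq1 : (1 : ℝ) ≤ q := by exact_mod_cast hq
  have hwk : ∀ k, g ≤ k → 2 ≤ w ^ k := fun k hk =>
    le_trans (by linarith) (pow_le_pow_right₀ hw.le hk)
  have hu : w ≤ romR κ n := by
    rw [← pow_le_pow_iff_left₀ (by linarith) (romR_nonneg κ n) hκ0, romR_pow κ n hκ0]
    have e : (w ^ 2) ^ κ = w ^ κ * w ^ κ := by rw [← pow_mul, mul_comm, mul_two, pow_add]
    rw [e] at hn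
    have := hwk κ hκ
    nlinarith
  have hn1 : 1 ≤ n := by
    rcases Nat.eq_zero_or_pos n with h | h
    · subst h
      have : romR κ 0 = 0 := by
        have := romR_pow κ 0 hκ0
        simpa [hκ0] using this
      linarith
    · exact h
  have hn1' : (1 : ℝ) ≤ n := by exact_mod_cast hn1
  obtain ⟨k, rfl⟩ := Nat.exists_eq_succ_of_ne_zero hκ0
  simp only [Nat.succ_eq_add_one] at *
  set u := romR (k + 1) n with hudef
  set v := romR (k + 1) (n + 1) with hvdef
  have huk : u ^ (k + 1) = n := romR_pow _ _ (by omega)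
  have hvk : v ^ (k + 1) = n + 1 := by have := romR_pow (k + 1) (n + 1) (by omega); push_cast at this; exact this
  have huv : u < v := by
    rw [← pow_lt_pow_iff_left₀ (by linarith) (romR_nonneg _ _) (by omega : k + 1 ≠ 0), huk, hvk]
    linarith
  refine ⟨by linarith, huv, ?_⟩
  intro j hj
  refine ⟨(hwk j (by omega)).trans (pow_le_pow_left₀ (by linarith) hu j), ?_⟩
  have hlow := romR_diff_lower k n
  change 1 ≤ (k + 1) * v ^ k * (v - u) at hlow
  have hu0 : 0 < u := by linarith
  have hv0 : 0 < v := by linarith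
  -- v^k ≤ 2 u^k
  have hvu : v ^ k ≤ 2 * u ^ k := by
    have e : v ^ (k + 1) ≤ 2 * u ^ (k + 1) := by rw [huk, hvk]; linarith
    rw [pow_succ, pow_succ] at e
    have h5 : 0 ≤ u ^ k := by positivity
    have h6 : v ^ k * v ≤ (2 * u ^ k) * v := by nlinarith
    exact le_of_mul_le_mul_right h6 hv0
  have h7 : (1 : ℝ) ≤ (k + 1) * (2 * u ^ k) * (v - u) := by
    refine hlow.trans ?_
    have : 0 ≤ v - u := by linarith
    gcongr
  have h8 : u ^ (j - 1) = u ^ k * u ^ (j - 1 - k) := by rw [← pow_add]; congr 1; omega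
  have h9 : w ^ g ≤ u ^ (j - 1 - k) := by
    calc w ^ g ≤ u ^ g := pow_le_pow_left₀ (by linarith) hu g
      _ ≤ u ^ (j - 1 - k) := pow_le_pow_right₀ (by linarith) (by omega)
  have h10 : ((k : ℝ) + 1) ≤ j := by exact_mod_cast (by omega : k + 1 ≤ j)
  have hd : 0 < v - u := by linarith
  calc (q : ℝ) = q * 1 := by ring
    _ ≤ q * ((k + 1) * (2 * u ^ k) * (v - u)) := by gcongr
    _ = (2 * q) * ((k + 1) * u ^ k * (v - u)) := by ring
    _ ≤ u ^ (j - 1 - k) * (j * u ^ k * (v - u)) := by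
        apply mul_le_mul (hg.trans h9) _ (by positivity) (by positivity)
        gcongr
    _ = j * (u ^ k * u ^ (j - 1 - k)) * (v - u) := by ring
    _ = _ := by rw [h8]

lemma rom_base (q g : ℕ) (hq : 1 ≤ q) (w b : ℝ) (hw : 1 < w) (hg : 2 * (q : ℝ) ≤ w ^ g) (hg2 : 2 ≤ g)
    (hb : w ^ 2 < b) (hgb : 1 ≤ g * (b - w ^ 2)) : romAdm q g (w ^ 2) b := by
  have hq1 : (1 : ℝ) ≤ q := by exact_mod_cast hq
  refine ⟨one_le_pow₀ hw.le, hb, ?_⟩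
  intro k hk
  have h1 : w ^ g ≤ w ^ k := pow_le_pow_right₀ hw.le hk
  have h2 : w ^ k ≤ (w ^ 2) ^ (k - 1) := by
    rw [← pow_mul]
    exact pow_le_pow_right₀ hw.le (by omega)
  have h3 : (w ^ 2) ^ (k - 1) ≤ (w ^ 2) ^ k := pow_le_pow_right₀ (one_le_pow₀ hw.le) (by omega)
  refine ⟨by linarith, ?_⟩
  have hkg : (g : ℝ) ≤ k := by exact_mod_cast hk
  have h4 : 1 ≤ k * (b - w ^ 2) := hgb.trans (by have : 0 ≤ b - w ^ 2 := by linarith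
                                                 gcongr)
  have h5 : (q : ℝ) ≤ (w ^ 2) ^ (k - 1) := by linarith
  nlinarith

end

section
open Finset MeasureTheory

/-- generating product -/
noncomputable def romf (q c g m κ : ℕ) (y : ℝ) : ENNReal :=
  ∏ j ∈ Finset.range m, (if ⌊y ^ (κ + j * g)⌋₊ % q = c then 2 else 1)

/-- residue events -/
def romE (q c k : ℕ) : Set ℝ := {y | ⌊y ^ k⌋₊ % q = c}

lemma romE_meas (q c k : ℕ) : MeasurableSet (romE q c k) := by
  have h : Measurable (fun y : ℝ => ⌊y ^ k⌋₊ % q) := by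
    have h1 : Measurable (fun y : ℝ => ⌊y ^ k⌋₊) := Nat.measurable_floor.comp (by fun_prop)
    exact (measurable_from_nat (f := fun n => n % q)).comp h1
  exact h (measurableSet_singleton c)

lemma romf_meas (q c g m κ : ℕ) : Measurable (romf q c g m κ) := by
  unfold romf
  apply Finset.measurable_fun_prod
  intro j _
  exact Measurable.ite (romE_meas q c (κ + j * g)) measurable_const measurable_const

lemma romf_succ (q c g m κ : ℕ) (y : ℝ) :
    romf q c g (m + 1) κ y = romf q c g m (κ + g) y + (romE q c κ).indicator (romf q c g m (κ + g)) y := by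
  unfold romf
  rw [Finset.prod_range_succ']
  have e : ∏ k ∈ Finset.range m, (if ⌊y ^ (κ + (k + 1) * g)⌋₊ % q = c then (2 : ENNReal) else 1) =
     ∏ k ∈ Finset.range m, (if ⌊y ^ (κ + g + k * g)⌋₊ % q = c then (2 : ENNReal) else 1) := by
    apply Finset.prod_congr rfl
    intro j _
    rw [show κ + (j + 1) * g = κ + g + j * g by ring]
  rw [e]
  simp only [zero_mul, add_zero]
  by_cases h : ⌊y ^ κ⌋₊ % q = c
  · rw [Set.indicator_of_mem (show y ∈ romE q c κ from h), if_pos h, mul_two]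
  · rw [Set.indicator_of_notMem (show y ∉ romE q c κ from h), if_neg h]; simp

lemma rom_mgf (q c g : ℕ) (hq : 1 ≤ q) (w : ℝ) (hw : 1 < w) (hg0 : g ≠ 0) (hg : 2 * (q : ℝ) ≤ w ^ g) (m : ℕ) :
    ∀ κ : ℕ, g ≤ κ → ∀ u v : ℝ, romAdm q κ u v →
      ∫⁻ y in Set.Ico u v ∩ Set.Ici (w ^ 2), romf q c g m κ y ≤
        ENNReal.ofReal ((1 + 5 / q) ^ m * (v - u)) := by
  have hq0 : (0 : ℝ) < q := by exact_mod_cast hq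
  induction m with
  | zero =>
    intro κ hκ u v hA
    simp only [romf, Finset.range_zero, Finset.prod_empty, lintegral_const, one_mul, pow_zero]
    rw [Measure.restrict_apply_univ, ← Real.volume_Ico]
    exact measure_mono Set.inter_subset_left
  | succ m ih =>
    intro κ hκ u v hA
    have hκ0 : κ ≠ 0 := by omega
    simp_rw [romf_succ]
    rw [lintegral_add_left (romf_meas _ _ _ _ _), lintegral_indicator (romE_meas q c κ),
      Measure.restrict_restrict (romE_meas q c κ)]
    have h1 := ih (κ + g) (by omega) u v (romAdm_mono _ _ _ _ _ hA (by omega))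
    have hu1 := hA.1
    have huv := hA.2.1
    set T := (Finset.range (⌈v ^ κ⌉₊ + 1)).filter
      (fun n : ℕ => n % q = c ∧ u ^ κ < n + 1 ∧ (n : ℝ) < v ^ κ ∧ (w ^ 2) ^ κ < n + 1) with hT
    have hsub : romE q c κ ∩ (Set.Ico u v ∩ Set.Ici (w ^ 2)) ⊆
        ⋃ n ∈ T, (Set.Ico (romR κ n) (romR κ (n + 1)) ∩ Set.Ici (w ^ 2)) := by
      rintro y ⟨hy1, ⟨hy2, hy3⟩, hy4⟩
      rw [Set.mem_Ici] at hy4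
      have hy0 : 0 ≤ y := by linarith
      simp only [Set.mem_iUnion]
      have hf1 : (⌊y ^ κ⌋₊ : ℝ) ≤ y ^ κ := Nat.floor_le (by positivity)
      have hf2 : y ^ κ < ⌊y ^ κ⌋₊ + 1 := Nat.lt_floor_add_one _
      have hyv : y ^ κ < v ^ κ := pow_lt_pow_left₀ hy3 hy0 hκ0
      have hyu : u ^ κ ≤ y ^ κ := pow_le_pow_left₀ (by linarith) hy2 κ
      have hyw : (w ^ 2) ^ κ ≤ y ^ κ := pow_le_pow_left₀ (by positivity) hy4 κ
      refine ⟨⌊y ^ κ⌋₊, ?_, (romR_floor κ _ hκ0 y hy0).2 rfl, hy4⟩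
      rw [hT, Finset.mem_filter, Finset.mem_range]
      refine ⟨?_, hy1, by linarith, by linarith, by linarith⟩
      have : ((⌊y ^ κ⌋₊ : ℕ) : ℝ) < v ^ κ := by linarith
      have := Nat.lt_ceil.2 this
      omega
    have h2 : ∫⁻ y in romE q c κ ∩ (Set.Ico u v ∩ Set.Ici (w ^ 2)), romf q c g m (κ + g) y ≤
        ∑ n ∈ T, ENNReal.ofReal ((1 + 5 / q) ^ m * romL κ n) := by
      calc _ ≤ ∫⁻ y in ⋃ n ∈ T, (Set.Ico (romR κ n) (romR κ (n + 1)) ∩ Set.Ici (w ^ 2)), romf q c g m (κ + g) y :=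
            lintegral_mono_set hsub
        _ ≤ ∑ n ∈ T, ∫⁻ y in (Set.Ico (romR κ n) (romR κ (n + 1)) ∩ Set.Ici (w ^ 2)), romf q c g m (κ + g) y := by
            apply le_of_eq
            apply lintegral_biUnion_finset
            · intro i _ j _ hij
              rw [Function.onFun, Set.disjoint_left]
              rintro y ⟨hy1, hy2⟩ ⟨hy3, _⟩
              have hy0 : 0 ≤ y := (romR_nonneg κ i).trans hy1.1
              rw [romR_floor κ _ hκ0 y hy0] at hy1 hy3
              exact hij (hy1.symm.trans hy3)
            · intro n _
              exact measurableSet_Ico.inter measurableSet_Ici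
        _ ≤ _ := by
            apply Finset.sum_le_sum
            intro n hn
            rw [hT, Finset.mem_filter] at hn
            exact ih (κ + g) (by omega) _ _ (rom_lemB q κ g n hq w hw hg hκ0 hκ hn.2.2.2.2)
    have h3 := rom_lemA q c κ hq hκ0 u v hA T (by
      intro n hn
      rw [hT, Finset.mem_filter] at hn
      exact ⟨hn.2.1, hn.2.2.1, hn.2.2.2.1⟩)
    rw [← ENNReal.ofReal_sum_of_nonneg (fun n _ => mul_nonneg (by positivity) (romL_nonneg κ n)), ← Finset.mul_sum] at h2
    refine (add_le_add h1 h2).trans ?_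
    rw [← ENNReal.ofReal_add (mul_nonneg (by positivity) (by linarith))
      (mul_nonneg (by positivity) (Finset.sum_nonneg (fun n _ => romL_nonneg κ n)))]
    apply ENNReal.ofReal_le_ofReal
    have h4 : (1 + 5 / (q : ℝ)) ^ m * ∑ n ∈ T, romL κ n ≤ (1 + 5 / (q : ℝ)) ^ m * (5 / q * (v - u)) :=
      mul_le_mul_of_nonneg_left h3 (by positivity)
    rw [pow_succ]
    linarith

/-- number of hits in progression -/
noncomputable def romX (q c g m κ : ℕ) (y : ℝ) : ℕ := #((Finset.range m).filter (fun j => ⌊y ^ (κ + j * g)⌋₊ % q = c))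

lemma romf_eq (q c g m κ : ℕ) (y : ℝ) : romf q c g m κ y = 2 ^ romX q c g m κ y := by
  unfold romf romX
  rw [Finset.prod_ite]; simp

lemma rom_markov (q c g : ℕ) (hq : 1 ≤ q) (w : ℝ) (hw : 1 < w) (hg0 : g ≠ 0) (hg : 2 * (q : ℝ) ≤ w ^ g) (m s : ℕ)
    (κ : ℕ) (hκ : g ≤ κ) (u v : ℝ) (hA : romAdm q κ u v) :
    volume ((Set.Ico u v ∩ Set.Ici (w ^ 2)) ∩ {y | 8 * (m : ℝ) / q + s ≤ romX q c g m κ y}) ≤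
      ENNReal.ofReal ((1 / 2) ^ s * (v - u)) := by
  have hq0 : (0 : ℝ) < q := by exact_mod_cast hq
  have hm := rom_mgf q c g hq w hw hg0 hg m κ hκ u v hA
  have huv := hA.2.1
  set S := Set.Ico u v ∩ Set.Ici (w ^ 2) with hS
  have hSm : MeasurableSet S := measurableSet_Ico.inter measurableSet_Ici
  set P : ℝ := (2 : ℝ) ^ (8 * (m : ℝ) / q + s) with hP
  have hP0 : 0 < P := by positivity
  have hmk := mul_meas_ge_le_lintegral (μ := volume.restrict S) (romf_meas q c g m κ) (ENNReal.ofReal P)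
  have hset : S ∩ {y | 8 * (m : ℝ) / q + s ≤ romX q c g m κ y} ⊆ {y | ENNReal.ofReal P ≤ romf q c g m κ y} ∩ S := by
    rintro y ⟨hy1, hy2⟩
    refine ⟨?_, hy1⟩
    have hy2' : 8 * (m : ℝ) / q + s ≤ romX q c g m κ y := hy2
    show ENNReal.ofReal P ≤ romf q c g m κ y
    rw [romf_eq]
    have e : (2 : ENNReal) ^ romX q c g m κ y = ENNReal.ofReal ((2 : ℝ) ^ (romX q c g m κ y)) := by
      rw [ENNReal.ofReal_pow (by norm_num)]; simp
    rw [e]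
    apply ENNReal.ofReal_le_ofReal
    rw [hP, ← Real.rpow_natCast]
    exact Real.rpow_le_rpow_of_exponent_le (by norm_num) hy2'
  have hm2 : ENNReal.ofReal P * volume (S ∩ {y | 8 * (m : ℝ) / q + s ≤ romX q c g m κ y}) ≤
      ENNReal.ofReal ((1 + 5 / q) ^ m * (v - u)) := by
    refine le_trans ?_ (hmk.trans hm)
    apply mul_le_mul_right
    rw [Measure.restrict_apply (measurableSet_le measurable_const (romf_meas q c g m κ))]
    exact measure_mono hset
  have hkey : (1 + 5 / (q : ℝ)) ^ m * (v - u) ≤ P * ((1 / 2) ^ s * (v - u)) := by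
    have h1 : (1 + 5 / (q : ℝ)) ^ m ≤ (2 : ℝ) ^ (8 * (m : ℝ) / q) := by
      have h2 : 1 + 5 / (q : ℝ) ≤ (2 : ℝ) ^ (8 / (q : ℝ)) := by
        have h3 := Real.add_one_le_exp (5 / (q : ℝ))
        have h4 : Real.exp (5 / (q : ℝ)) ≤ (2 : ℝ) ^ (8 / (q : ℝ)) := by
          rw [Real.rpow_def_of_pos (by norm_num)]
          apply Real.exp_le_exp.2
          rw [← mul_div_assoc]
          have := Real.log_two_gt_d9
          gcongr
          linarith
        linarith
      calc (1 + 5 / (q : ℝ)) ^ m ≤ ((2 : ℝ) ^ (8 / (q : ℝ))) ^ m := by gcongr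
        _ = _ := by rw [← Real.rpow_natCast, ← Real.rpow_mul (by norm_num)]; congr 1; ring
    have h5 : P * (1 / 2) ^ s = (2 : ℝ) ^ (8 * (m : ℝ) / q) := by
      rw [hP, Real.rpow_add (by norm_num), Real.rpow_natCast, mul_assoc, ← mul_pow]; norm_num
    rw [← mul_assoc, h5]
    exact mul_le_mul_of_nonneg_right h1 (by linarith)
  have hm3 := hm2.trans (ENNReal.ofReal_le_ofReal hkey)
  rw [ENNReal.ofReal_mul hP0.le] at hm3
  exact (ENNReal.mul_le_mul_iff_right (by simpa using hP0) ENNReal.ofReal_ne_top).1 hm3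

end

section
open Finset MeasureTheory Filter

/-- exceptional set -/
def romB (w b : ℝ) (Q s : ℕ) : Set ℝ :=
  ⋃ q ∈ Finset.Icc 1 (Q * s ^ 4), ⋃ c ∈ Finset.range q, ⋃ r ∈ Finset.range s,
    ((Set.Ico (w ^ 2) b ∩ Set.Ici (w ^ 2)) ∩ {y | 8 * ((s ^ 3 : ℕ) : ℝ) / q + s ≤ romX q c s (s ^ 3) (s + r) y})

lemma romB_vol (w b : ℝ) (Q s : ℕ) (hw : 1 < w) (hb : w ^ 2 < b) (h1 : 2 * ((Q * s ^ 4 : ℕ) : ℝ) ≤ w ^ s)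
    (h2 : 2 ≤ s) (h3 : 1 ≤ s * (b - w ^ 2)) :
    volume (romB w b Q s) ≤ ENNReal.ofReal ((Q : ℝ) ^ 2 * (b - w ^ 2) * ((s : ℝ) ^ 9 * (1 / 2) ^ s)) := by
  have hbw : 0 < b - w ^ 2 := by linarith
  set V := ENNReal.ofReal ((1 / 2) ^ s * (b - w ^ 2)) with hV
  have hb1 : ∀ q ∈ Finset.Icc 1 (Q * s ^ 4), ∀ c ∈ Finset.range q, ∀ r ∈ Finset.range s,
      volume ((Set.Ico (w ^ 2) b ∩ Set.Ici (w ^ 2)) ∩ {y | 8 * ((s ^ 3 : ℕ) : ℝ) / q + s ≤ romX q c s (s ^ 3) (s + r) y}) ≤ V := by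
    intro q hq c _ r _
    rw [Finset.mem_Icc] at hq
    have hq' : (q : ℝ) ≤ (Q * s ^ 4 : ℕ) := by exact_mod_cast hq.2
    have hqw : 2 * (q : ℝ) ≤ w ^ s := by linarith
    exact rom_markov q c s hq.1 w hw (by omega) hqw (s ^ 3) s (s + r) (by omega) (w ^ 2) b
      (romAdm_mono _ _ _ _ _ (rom_base q s hq.1 w b hw hqw h2 hb h3) (by omega))
  calc volume (romB w b Q s) ≤ ∑ q ∈ Finset.Icc 1 (Q * s ^ 4), ∑ c ∈ Finset.range q, ∑ r ∈ Finset.range s, V := by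
        refine (measure_biUnion_finset_le _ _).trans ?_
        apply Finset.sum_le_sum; intro q hq
        refine (measure_biUnion_finset_le _ _).trans ?_
        apply Finset.sum_le_sum; intro c hc
        refine (measure_biUnion_finset_le _ _).trans ?_
        apply Finset.sum_le_sum; intro r hr
        exact hb1 q hq c hc r hr
    _ ≤ ∑ q ∈ Finset.Icc 1 (Q * s ^ 4), ((Q * s ^ 4 * s : ℕ) : ENNReal) * V := by
        apply Finset.sum_le_sum; intro q hq
        rw [Finset.mem_Icc] at hq
        simp only [Finset.sum_const, Finset.card_range, nsmul_eq_mul]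
        rw [← mul_assoc, ← Nat.cast_mul]
        gcongr
        exact hq.2
    _ = (((Q * s ^ 4) * (Q * s ^ 4 * s) : ℕ) : ENNReal) * V := by
        simp only [Finset.sum_const, Nat.card_Icc, nsmul_eq_mul, Nat.add_sub_cancel]
        rw [← mul_assoc, ← Nat.cast_mul]
    _ = _ := by
        rw [hV, ← ENNReal.ofReal_natCast, ← ENNReal.ofReal_mul (by positivity)]
        congr 1
        push_cast
        ring

lemma rom_split (q c s : ℕ) (hs : 1 ≤ s) (y : ℝ) (R : ℝ) (hR : ∀ r < s, (romX q c s (s ^ 3) (s + r) y : ℝ) ≤ R) :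
    (#((Finset.Icc 1 (s ^ 4)).filter (fun k => ⌊y ^ k⌋₊ % q = c)) : ℝ) ≤ s + s * R := by
  have hsub : (Finset.Icc 1 (s ^ 4)).filter (fun k => ⌊y ^ k⌋₊ % q = c) ⊆
      Finset.range s ∪ (Finset.range s).biUnion (fun r =>
        ((Finset.range (s ^ 3)).filter (fun j => ⌊y ^ (s + r + j * s)⌋₊ % q = c)).image (fun j => s + r + j * s)) := by
    intro k hk
    rw [Finset.mem_filter, Finset.mem_Icc] at hk
    rw [Finset.mem_union, Finset.mem_range, Finset.mem_biUnion]
    by_cases hks : k < s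
    · left; exact hks
    · right
      push Not at hks
      have hd := Nat.div_add_mod k s
      have h1 : 1 ≤ k / s := Nat.div_pos hks hs
      have e : s + k % s + (k / s - 1) * s = k := by
        obtain ⟨t, ht⟩ := Nat.exists_eq_add_of_le h1
        rw [ht] at hd ⊢
        simp only [Nat.add_sub_cancel_left]
        nlinarith
      refine ⟨k % s, Finset.mem_range.2 (Nat.mod_lt _ hs), ?_⟩
      rw [Finset.mem_image]
      refine ⟨k / s - 1, ?_, e⟩
      rw [Finset.mem_filter, Finset.mem_range, e]
      refine ⟨?_, hk.2⟩
      have : k / s ≤ s ^ 3 := by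
        apply Nat.div_le_of_le_mul
        calc k ≤ s ^ 4 := hk.1.2
          _ = s * s ^ 3 := by ring
      omega
  have h1 := (Finset.card_le_card hsub).trans (Finset.card_union_le _ _)
  have h2 := Finset.card_biUnion_le (s := Finset.range s) (t := fun r =>
        ((Finset.range (s ^ 3)).filter (fun j => ⌊y ^ (s + r + j * s)⌋₊ % q = c)).image (fun j => s + r + j * s))
  have h3 : ∑ r ∈ Finset.range s, #(((Finset.range (s ^ 3)).filter (fun j => ⌊y ^ (s + r + j * s)⌋₊ % q = c)).image (fun j => s + r + j * s))
      ≤ ∑ r ∈ Finset.range s, romX q c s (s ^ 3) (s + r) y :=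
    Finset.sum_le_sum (fun r _ => Finset.card_image_le)
  have h4 : ((∑ r ∈ Finset.range s, romX q c s (s ^ 3) (s + r) y : ℕ) : ℝ) ≤ s * R := by
    push_cast
    have := Finset.sum_le_card_nsmul (Finset.range s) (fun r => (romX q c s (s ^ 3) (s + r) y : ℝ)) R
      (fun r hr => hR r (Finset.mem_range.1 hr))
    simpa using this
  rw [Finset.card_range] at h1
  have h5 : (#((Finset.Icc 1 (s ^ 4)).filter (fun k => ⌊y ^ k⌋₊ % q = c))) ≤ s + ∑ r ∈ Finset.range s, romX q c s (s ^ 3) (s + r) y := by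
    omega
  have h6 : (#((Finset.Icc 1 (s ^ 4)).filter (fun k => ⌊y ^ k⌋₊ % q = c)) : ℝ) ≤ s + ((∑ r ∈ Finset.range s, romX q c s (s ^ 3) (s + r) y : ℕ) : ℝ) := by
    exact_mod_cast h5
  linarith

theorem rom_ae (w b : ℝ) (Q : ℕ) (hw : 1 < w) (hb : w ^ 2 < b) :
    ∀ᵐ y : ℝ, y ∈ Set.Ico (w ^ 2) b → ∃ s0 : ℕ, ∀ s : ℕ, s0 ≤ s → ∀ q : ℕ, 1 ≤ q → q ≤ Q * s ^ 4 → ∀ c : ℕ,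
      (#((Finset.Icc 1 (s ^ 4)).filter (fun k => ⌊y ^ k⌋₊ % q = c)) : ℝ) ≤ 8 * (s : ℝ) ^ 4 / q + 2 * (s : ℝ) ^ 2 := by
  have hbw : 0 < b - w ^ 2 := by linarith
  have ev1 : ∀ᶠ s : ℕ in atTop, 2 * ((Q * s ^ 4 : ℕ) : ℝ) ≤ w ^ s := by
    have h := tendsto_pow_const_div_const_pow_of_one_lt 4 hw
    have h2 : ∀ᶠ s : ℕ in atTop, (s : ℝ) ^ 4 / w ^ s < 1 / (2 * Q + 1) :=
      h.eventually_lt_const (by positivity)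
    filter_upwards [h2] with s hs
    rw [div_lt_div_iff₀ (by positivity) (by positivity)] at hs
    push_cast
    have : (0 : ℝ) ≤ (s : ℝ) ^ 4 := by positivity
    linarith
  have ev2 : ∀ᶠ s : ℕ in atTop, 2 ≤ s := eventually_ge_atTop 2
  have ev3 : ∀ᶠ s : ℕ in atTop, 1 ≤ (s : ℝ) * (b - w ^ 2) := by
    have h : Tendsto (fun s : ℕ => (s : ℝ) * (b - w ^ 2)) atTop atTop :=
      tendsto_natCast_atTop_atTop.atTop_mul_const hbw
    exact h.eventually_ge_atTop 1
  obtain ⟨s1, hs1⟩ := Filter.eventually_atTop.1 (ev1.and (ev2.and ev3))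
  have hsum : Summable (fun s : ℕ => (Q : ℝ) ^ 2 * (b - w ^ 2) * ((s : ℝ) ^ 9 * (1 / 2) ^ s)) := by
    apply Summable.mul_left
    exact summable_pow_mul_geometric_of_norm_lt_one 9 (by norm_num)
  have hsum2 : Summable (fun s : ℕ => (Q : ℝ) ^ 2 * (b - w ^ 2) * (((s + s1 : ℕ) : ℝ) ^ 9 * (1 / 2) ^ (s + s1))) :=
    (summable_nat_add_iff s1).2 hsum
  have hfin : ∑' s : ℕ, volume (romB w b Q (s + s1)) ≠ ⊤ := by
    refine ne_top_of_le_ne_top hsum2.tsum_ofReal_ne_top ?_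
    apply ENNReal.tsum_le_tsum
    intro s
    obtain ⟨h1, h2, h3⟩ := hs1 (s + s1) (by omega)
    exact romB_vol w b Q (s + s1) hw hb h1 h2 h3
  have hae := ae_eventually_notMem hfin
  filter_upwards [hae] with y hy hyI
  obtain ⟨s2, hs2⟩ := Filter.eventually_atTop.1 hy
  refine ⟨s1 + s2 + 2, ?_⟩
  intro s hs q hq1 hq2 c
  have hnot := hs2 (s - s1) (by omega)
  rw [show s - s1 + s1 = s by omega] at hnot
  have hq0 : (0 : ℝ) < q := by exact_mod_cast hq1
  by_cases hc : c < q
  · have hX : ∀ r < s, (romX q c s (s ^ 3) (s + r) y : ℝ) ≤ 8 * ((s ^ 3 : ℕ) : ℝ) / q + s := by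
      intro r hr
      by_contra hcon
      push Not at hcon
      apply hnot
      unfold romB
      simp only [Set.mem_iUnion]
      exact ⟨q, Finset.mem_Icc.2 ⟨hq1, hq2⟩, c, Finset.mem_range.2 hc, r, Finset.mem_range.2 hr, ⟨hyI, hyI.1⟩, hcon.le⟩
    have h1 := rom_split q c s (by omega) y _ hX
    refine h1.trans ?_
    have hs1' : (1 : ℝ) ≤ s := by exact_mod_cast (by omega : 1 ≤ s)
    have e : (s : ℝ) * (8 * ((s ^ 3 : ℕ) : ℝ) / q + s) = 8 * (s : ℝ) ^ 4 / q + s ^ 2 := by push_cast; ring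
    rw [e]
    nlinarith
  · have : (Finset.Icc 1 (s ^ 4)).filter (fun k => ⌊y ^ k⌋₊ % q = c) = ∅ := by
      apply Finset.filter_eq_empty_iff.2
      intro k _ h
      have := Nat.mod_lt ⌊y ^ k⌋₊ hq1
      omega
    rw [this]
    simp only [Finset.card_empty, Nat.cast_zero]
    positivity

end

section
open Finset MeasureTheory Filter

lemma rom_energy {α : Type*} [DecidableEq α] (S : Finset α) (φ : α → ℕ) :
    (#S : ℝ) ^ 2 ≤ #(S.image φ) * #((S ×ˢ S).filter (fun t => φ t.1 = φ t.2)) := by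
  have h1 : #S = ∑ n ∈ S.image φ, #(S.filter (fun a => φ a = n)) := Finset.card_eq_sum_card_image φ S
  have h2 : #((S ×ˢ S).filter (fun t => φ t.1 = φ t.2)) = ∑ n ∈ S.image φ, #(S.filter (fun a => φ a = n)) ^ 2 := by
    rw [Finset.card_eq_sum_card_fiberwise (f := fun t => φ t.1) (t := S.image φ)]
    · apply Finset.sum_congr rfl
      intro n _
      rw [sq, ← Finset.card_product]
      congr 1
      ext ⟨a, b⟩
      simp only [Finset.mem_filter, Finset.mem_product]
      constructor
      · rintro ⟨⟨⟨h1, h2⟩, h3⟩, h4⟩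
        exact ⟨⟨h1, h4⟩, h2, h3 ▸ h4⟩
      · rintro ⟨⟨h1, h4⟩, h2, h3⟩
        exact ⟨⟨⟨h1, h2⟩, h4.trans h3.symm⟩, h4⟩
    · intro t ht
      simp only [Finset.coe_filter, Finset.mem_product, Set.mem_ofPred_eq] at ht
      exact Finset.mem_coe.2 (Finset.mem_image_of_mem _ ht.1.1)
  rw [h2, h1]
  have := sq_sum_le_card_mul_sum_sq (s := S.image φ) (f := fun n => #(S.filter (fun a => φ a = n)))
  exact_mod_cast this

/-- prime pairs counting function -/
def romW (n0 h : ℕ) : ℕ := #((Finset.Ioc 0 n0).filter (fun n => n.Prime ∧ (n + h).Prime))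

lemma rom_E_le (n0 : ℕ) (I : Finset ℕ) (F : ℕ → ℕ) :
    #(((((Finset.Ioc 0 n0).filter Nat.Prime) ×ˢ I) ×ˢ (((Finset.Ioc 0 n0).filter Nat.Prime) ×ˢ I)).filter
      (fun t => t.1.1 + F t.1.2 = t.2.1 + F t.2.2)) ≤ ∑ k1 ∈ I, ∑ k2 ∈ I, romW n0 (Nat.dist (F k1) (F k2)) := by
  rw [← Finset.sum_product']
  rw [Finset.card_eq_sum_card_fiberwise (f := fun t => (t.1.2, t.2.2)) (t := I ×ˢ I)]
  · apply Finset.sum_le_sum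
    rintro ⟨k1, k2⟩ _
    simp only
    unfold romW
    rcases le_total (F k1) (F k2) with h | h
    · apply Finset.card_le_card_of_injOn (fun t => t.2.1)
      · rintro ⟨⟨p1, j1⟩, ⟨p2, j2⟩⟩ ht
        simp only [Finset.coe_filter, Finset.mem_filter, Finset.mem_product, Set.mem_ofPred_eq, Prod.mk.injEq] at ht ⊢
        obtain ⟨⟨⟨⟨⟨h1, h2⟩, h3⟩, ⟨h4, h5⟩, h6⟩, h7⟩, rfl, rfl⟩ := ht
        rw [Nat.dist_eq_sub_of_le h]
        have e : p2 + (F j2 - F j1) = p1 := by omega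
        rw [e]
        exact ⟨h4, h5, h2⟩
      · rintro ⟨⟨p1, j1⟩, ⟨p2, j2⟩⟩ ht ⟨⟨p3, j3⟩, ⟨p4, j4⟩⟩ ht2 heq
        simp only [Finset.coe_filter, Finset.mem_filter, Finset.mem_product, Set.mem_ofPred_eq, Prod.mk.injEq] at ht ht2 heq ⊢
        obtain ⟨⟨_, h7⟩, rfl, rfl⟩ := ht
        obtain ⟨⟨_, h8⟩, rfl, rfl⟩ := ht2
        omega
    · apply Finset.card_le_card_of_injOn (fun t => t.1.1)
      · rintro ⟨⟨p1, j1⟩, ⟨p2, j2⟩⟩ ht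
        simp only [Finset.coe_filter, Finset.mem_filter, Finset.mem_product, Set.mem_ofPred_eq, Prod.mk.injEq] at ht ⊢
        obtain ⟨⟨⟨⟨⟨h1, h2⟩, h3⟩, ⟨h4, h5⟩, h6⟩, h7⟩, rfl, rfl⟩ := ht
        rw [Nat.dist_eq_sub_of_le_right h]
        have e : p1 + (F j1 - F j2) = p2 := by omega
        rw [e]
        exact ⟨h1, h2, h5⟩
      · rintro ⟨⟨p1, j1⟩, ⟨p2, j2⟩⟩ ht ⟨⟨p3, j3⟩, ⟨p4, j4⟩⟩ ht2 heq
        simp only [Finset.coe_filter, Finset.mem_filter, Finset.mem_product, Set.mem_ofPred_eq, Prod.mk.injEq] at ht ht2 heq ⊢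
        obtain ⟨⟨_, h7⟩, rfl, rfl⟩ := ht
        obtain ⟨⟨_, h8⟩, rfl, rfl⟩ := ht2
        omega
  · intro t ht
    simp only [Finset.coe_filter, Finset.mem_product, Set.mem_ofPred_eq] at ht
    simp only [Finset.coe_product, Set.mem_prod, Finset.mem_coe]
    exact ⟨ht.1.1.2, ht.1.2.2⟩

lemma rom_dvd_dist (q x y : ℕ) : q ∣ Nat.dist x y ↔ y % q = x % q := by
  rcases le_total x y with h | h
  · rw [Nat.dist_eq_sub_of_le h]
    exact (Nat.modEq_iff_dvd' h).symm.trans ⟨fun h => h.symm, fun h => h.symm⟩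
  · rw [Nat.dist_eq_sub_of_le_right h]
    exact (Nat.modEq_iff_dvd' h).symm

lemma rom_fiber (w y : ℝ) (hw : 1 < w) (hy : w ≤ y) (m : ℕ) (hm : 2 ≤ w ^ m) (K k1 : ℕ) :
    #((Finset.Icc 1 K).filter (fun k2 => ⌊y ^ k2⌋₊ = ⌊y ^ k1⌋₊)) ≤ 2 * m := by
  have hy0 : 0 < y := by linarith
  have key : ∀ k k' : ℕ, ⌊y ^ k⌋₊ = ⌊y ^ k'⌋₊ → k' < k + m := by
    intro k k' h
    by_contra hc
    push Not at hc
    have h1 : y ^ k' < ⌊y ^ k⌋₊ + 1 := by rw [h]; exact Nat.lt_floor_add_one _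
    have h2 : (⌊y ^ k⌋₊ : ℝ) ≤ y ^ k := Nat.floor_le (by positivity)
    have h3 : 1 ≤ y ^ k := one_le_pow₀ (by linarith)
    have h4 : y ^ k * y ^ m ≤ y ^ k' := by
      rw [← pow_add]; exact pow_le_pow_right₀ (by linarith) hc
    have h5 : 2 ≤ y ^ m := hm.trans (pow_le_pow_left₀ (by linarith) hy m)
    nlinarith
  have hsub : (Finset.Icc 1 K).filter (fun k2 => ⌊y ^ k2⌋₊ = ⌊y ^ k1⌋₊) ⊆ Finset.Ico (k1 + 1 - m) (k1 + m) := by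
    intro k hk
    rw [Finset.mem_filter] at hk
    rw [Finset.mem_Ico]
    have h1 := key k k1 hk.2
    have h2 := key k1 k hk.2.symm
    omega
  have := Finset.card_le_card hsub
  rw [Nat.card_Ico] at this
  omega

lemma rom_sum_rsqrt (B : ℕ) : ∑ q ∈ Finset.Icc 1 B, 1 / Real.sqrt q ≤ 2 * Real.sqrt B := by
  induction B with
  | zero => simp
  | succ B ih =>
    rw [Finset.sum_Icc_succ_top (by omega)]
    have h1 : 0 < Real.sqrt ((B + 1 : ℕ) : ℝ) := Real.sqrt_pos.2 (by positivity)
    have h2 : Real.sqrt ((B + 1 : ℕ) : ℝ) ^ 2 = B + 1 := by rw [Real.sq_sqrt (by positivity)]; push_cast; ring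
    have h3 : Real.sqrt (B : ℝ) ^ 2 = B := Real.sq_sqrt (by positivity)
    have h4 : 1 / Real.sqrt ((B + 1 : ℕ) : ℝ) ≤ 2 * Real.sqrt ((B + 1 : ℕ) : ℝ) - 2 * Real.sqrt (B : ℝ) := by
      rw [div_le_iff₀ h1]
      nlinarith [sq_nonneg (Real.sqrt ((B + 1 : ℕ) : ℝ) - Real.sqrt (B : ℝ))]
    linarith

lemma rom_sum_rsqrt3 (B : ℕ) : ∑ q ∈ Finset.Icc 1 B, 1 / Real.sqrt q * (1 / q) ≤ 3 := by
  have h : ∀ B : ℕ, ∑ q ∈ Finset.Icc 1 (B + 1), 1 / Real.sqrt q * (1 / q) ≤ 3 - 2 / Real.sqrt ((B + 1 : ℕ) : ℝ) := by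
    intro B
    induction B with
    | zero => norm_num
    | succ B ih =>
      rw [Finset.sum_Icc_succ_top (by omega)]
      set s := Real.sqrt ((B + 1 : ℕ) : ℝ) with hs
      set t := Real.sqrt ((B + 1 + 1 : ℕ) : ℝ) with ht
      have h1 : 0 < s := Real.sqrt_pos.2 (by positivity)
      have h2 : 0 < t := Real.sqrt_pos.2 (by positivity)
      have h3 : s ^ 2 = ((B + 1 : ℕ) : ℝ) := Real.sq_sqrt (by positivity)
      have h4 : t ^ 2 = ((B + 1 + 1 : ℕ) : ℝ) := Real.sq_sqrt (by positivity)
      have h5 : t ^ 2 = s ^ 2 + 1 := by rw [h3, h4]; push_cast; ring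
      have h6 : 1 / t * (1 / ((B + 1 + 1 : ℕ) : ℝ)) ≤ 2 / s - 2 / t := by
        rw [← h4, one_div_mul_one_div, div_sub_div _ _ h1.ne' h2.ne', div_le_div_iff₀ (by positivity) (by positivity)]
        have hst : s ≤ t := by nlinarith
        have e : (t - s) * (t + s) = 1 := by nlinarith
        have e2 : 1 ≤ (t - s) * (2 * t) := by nlinarith
        have e3 : s * 1 ≤ t * ((t - s) * (2 * t)) := mul_le_mul hst e2 (by norm_num) h2.le
        nlinarith
      linarith
  rcases B with _ | B
  · simp
  · have h1 := h B
    have : 0 ≤ 2 / Real.sqrt ((B + 1 : ℕ) : ℝ) := by positivity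
    linarith

end

section
open Finset MeasureTheory Filter

lemma rom_divsum (K s Q : ℕ) (F : ℕ → ℕ) (hK : K ≤ s ^ 4) 
    (H : ∀ q, 1 ≤ q → q ≤ Q * s ^ 4 → ∀ c, (#((Finset.Icc 1 (s^4)).filter (fun k => F k % q = c)) : ℝ)
      ≤ 8 * (s:ℝ)^4 / q + 2 * (s:ℝ)^2) :
    ∑ k1 ∈ Finset.Icc 1 K, ∑ k2 ∈ Finset.Icc 1 K,
      ∑ q ∈ (Finset.Icc 1 (Q * s^4)).filter (· ∣ Nat.dist (F k1) (F k2)), 1 / Real.sqrt q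
    ≤ K * (s:ℝ)^4 * (24 + 4 * Real.sqrt Q) := by
  have h1 : ∀ k1 ∈ Finset.Icc 1 K, ∑ k2 ∈ Finset.Icc 1 K,
      ∑ q ∈ (Finset.Icc 1 (Q * s^4)).filter (· ∣ Nat.dist (F k1) (F k2)), 1 / Real.sqrt q
      ≤ (s:ℝ)^4 * (24 + 4 * Real.sqrt Q) := by
    intro k1 _
    simp_rw [Finset.sum_filter]
    rw [Finset.sum_comm]
    have h2 : ∀ q ∈ Finset.Icc 1 (Q * s^4), 
        ∑ k2 ∈ Finset.Icc 1 K, (if q ∣ Nat.dist (F k1) (F k2) then 1 / Real.sqrt q else 0)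
        ≤ 8 * (s:ℝ)^4 * (1 / Real.sqrt q * (1 / q)) + 2 * (s:ℝ)^2 * (1 / Real.sqrt q) := by
      intro q hq
      rw [Finset.mem_Icc] at hq
      rw [← Finset.sum_filter, Finset.sum_const, nsmul_eq_mul]
      have h3 : (#((Finset.Icc 1 K).filter (fun k2 => q ∣ Nat.dist (F k1) (F k2))) : ℝ)
          ≤ 8 * (s:ℝ)^4 / q + 2 * (s:ℝ)^2 := by
        refine le_trans ?_ (H q hq.1 hq.2 (F k1 % q))
        norm_cast
        apply Finset.card_le_card
        intro k hk
        rw [Finset.mem_filter, Finset.mem_Icc] at hk ⊢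
        exact ⟨⟨hk.1.1, hk.1.2.trans hK⟩, (rom_dvd_dist _ _ _).1 hk.2⟩
      have h4 : 0 ≤ 1 / Real.sqrt q := by positivity
      calc _ ≤ (8 * (s:ℝ)^4 / q + 2 * (s:ℝ)^2) * (1 / Real.sqrt q) := mul_le_mul_of_nonneg_right h3 h4
        _ = _ := by ring
    refine (Finset.sum_le_sum h2).trans ?_
    rw [Finset.sum_add_distrib, ← Finset.mul_sum, ← Finset.mul_sum]
    have h5 := rom_sum_rsqrt (Q * s^4)
    have h6 := rom_sum_rsqrt3 (Q * s^4)
    have h7 : Real.sqrt ((Q * s^4 : ℕ) : ℝ) = Real.sqrt Q * (s:ℝ)^2 := by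
      push_cast
      rw [Real.sqrt_mul (by positivity)]
      congr 1
      rw [show (s:ℝ)^4 = ((s:ℝ)^2)^2 by ring, Real.sqrt_sq (by positivity)]
    rw [h7] at h5
    calc _ ≤ 8 * (s:ℝ)^4 * 3 + 2 * (s:ℝ)^2 * (2 * (Real.sqrt Q * (s:ℝ)^2)) := by gcongr
      _ = _ := by ring
  refine (Finset.sum_le_sum h1).trans ?_
  rw [Finset.sum_const, nsmul_eq_mul, Nat.card_Icc]
  simp [mul_assoc]

lemma rom_Ebound (K s Q m n0 : ℕ) (A : ℝ) (hA : 0 ≤ A) (F : ℕ → ℕ) (hK : K ≤ s ^ 4) (hs : s ^ 4 ≤ 16 * K)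
    (H : ∀ q, 1 ≤ q → q ≤ Q * s ^ 4 → ∀ c, (#((Finset.Icc 1 (s^4)).filter (fun k => F k % q = c)) : ℝ)
      ≤ 8 * (s:ℝ)^4 / q + 2 * (s:ℝ)^2)
    (hB : 1 ≤ Q * s ^ 4)
    (hF : ∀ k ∈ Finset.Icc 1 K, F k ≤ 2 ^ (Q * s ^ 4))
    (hfib : ∀ k1, #((Finset.Icc 1 K).filter (fun k2 => F k2 = F k1)) ≤ 2 * m)
    (hp : ∀ h, h ≠ 0 → (romW n0 h : ℝ) ≤ A * romF h) :
    ((∑ k1 ∈ Finset.Icc 1 K, ∑ k2 ∈ Finset.Icc 1 K, romW n0 (Nat.dist (F k1) (F k2)) : ℕ) : ℝ) ≤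
      2 * m * K * #((Finset.Ioc 0 n0).filter Nat.Prime) + 3 * A * (1 + 32 * (24 + 4 * Real.sqrt Q)) * (K:ℝ)^2 := by
  push_cast
  have h1 : ∀ k1 ∈ Finset.Icc 1 K, ∀ k2 ∈ Finset.Icc 1 K, 
      (romW n0 (Nat.dist (F k1) (F k2)) : ℝ) ≤ 
      (if F k2 = F k1 then (#((Finset.Ioc 0 n0).filter Nat.Prime) : ℝ) else 0) + 
      (3 * A + 6 * A * ∑ q ∈ (Finset.Icc 1 (Q * s^4)).filter (· ∣ Nat.dist (F k1) (F k2)), 1 / Real.sqrt q) := by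
    intro k1 hk1 k2 hk2
    have hnn : 0 ≤ ∑ q ∈ (Finset.Icc 1 (Q * s^4)).filter (· ∣ Nat.dist (F k1) (F k2)), 1 / Real.sqrt q :=
      Finset.sum_nonneg (fun _ _ => by positivity)
    split_ifs with h
    · have : (romW n0 (Nat.dist (F k1) (F k2)) : ℝ) ≤ #((Finset.Ioc 0 n0).filter Nat.Prime) := by
        unfold romW
        norm_cast
        apply Finset.card_le_card
        intro n hn
        rw [Finset.mem_filter] at hn ⊢
        exact ⟨hn.1, hn.2.1⟩
      have : 0 ≤ 6 * A * ∑ q ∈ (Finset.Icc 1 (Q * s^4)).filter (· ∣ Nat.dist (F k1) (F k2)), 1 / Real.sqrt q := by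
        positivity
      linarith
    · have hd : Nat.dist (F k1) (F k2) ≠ 0 := fun h0 => h (Nat.eq_of_dist_eq_zero h0).symm
      have hle : Nat.dist (F k1) (F k2) ≤ 2 ^ (Q * s ^ 4) := by
        have a := hF k1 hk1
        have b := hF k2 hk2
        unfold Nat.dist
        omega
      have := rom_F_bound _ _ hd hB hle
      have h2 := hp _ hd
      have h3 := mul_le_mul_of_nonneg_left this hA
      refine h2.trans (h3.trans (le_of_eq ?_))
      ring
  refine (Finset.sum_le_sum (fun k1 hk1 => Finset.sum_le_sum (h1 k1 hk1))).trans ?_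
  simp_rw [Finset.sum_add_distrib, ← Finset.mul_sum]
  have h2 := rom_divsum K s Q F hK H
  have h3 : ∑ k1 ∈ Finset.Icc 1 K, ∑ k2 ∈ Finset.Icc 1 K, (if F k2 = F k1 then (#((Finset.Ioc 0 n0).filter Nat.Prime) : ℝ) else 0) ≤ 2 * m * K * #((Finset.Ioc 0 n0).filter Nat.Prime) := by
    have : ∀ k1 ∈ Finset.Icc 1 K, ∑ k2 ∈ Finset.Icc 1 K, (if F k2 = F k1 then (#((Finset.Ioc 0 n0).filter Nat.Prime) : ℝ) else 0) ≤ 2 * m * #((Finset.Ioc 0 n0).filter Nat.Prime) := by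
      intro k1 _
      rw [← Finset.sum_filter, Finset.sum_const, nsmul_eq_mul]
      have := hfib k1
      gcongr
      exact_mod_cast this
    refine (Finset.sum_le_sum this).trans ?_
    rw [Finset.sum_const, nsmul_eq_mul, Nat.card_Icc]
    simp only [add_tsub_cancel_right]
    apply le_of_eq; ring
  have h4 : 3 * ∑ k1 ∈ Finset.Icc 1 K, ∑ k2 ∈ Finset.Icc 1 K, A = 3 * A * (K:ℝ)^2 := by
    simp only [Finset.sum_const, nsmul_eq_mul, Nat.card_Icc, add_tsub_cancel_right]
    ring
  rw [h4]
  have h5 : (s:ℝ)^4 ≤ 16 * K := by exact_mod_cast hs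
  have h6 : 6 * A * ∑ k1 ∈ Finset.Icc 1 K, ∑ k2 ∈ Finset.Icc 1 K,
      ∑ q ∈ (Finset.Icc 1 (Q * s^4)).filter (· ∣ Nat.dist (F k1) (F k2)), 1 / Real.sqrt q ≤ 
      6 * A * (K * (16 * K) * (24 + 4 * Real.sqrt Q)) := by
    apply mul_le_mul_of_nonneg_left _ (by positivity)
    exact h2.trans (by gcongr)
  calc _ ≤ 2 * m * K * #((Finset.Ioc 0 n0).filter Nat.Prime) + (3 * A * (K:ℝ)^2 + 6 * A * (K * (16 * K) * (24 + 4 * Real.sqrt Q))) := by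
        gcongr
    _ = _ := by ring

lemma rom_pi_lower : ∃ N1 : ℕ, ∀ n, N1 ≤ n → (n:ℝ) / (2 * Real.log n) ≤ #((Finset.Ioc 0 n).filter Nat.Prime) := by
  have hlim : Tendsto (fun n : ℕ => Real.log n / (n:ℝ)) atTop (nhds 0) := by
    have := (Real.isLittleO_log_id_atTop.tendsto_div_nhds_zero).comp tendsto_natCast_atTop_atTop
    exact this
  have h2 := (hlim.eventually (gt_mem_nhds (show (0:ℝ) < 1/20 by norm_num)))
  obtain ⟨N1, hN1⟩ := eventually_atTop.1 h2
  refine ⟨max N1 10, fun n hn => ?_⟩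
  have hn1 : N1 ≤ n := (le_max_left _ _).trans hn
  have hn2 : 10 ≤ n := (le_max_right _ _).trans hn
  have hn3 : (10:ℝ) ≤ n := by exact_mod_cast hn2
  have hlog : 0 < Real.log n := Real.log_pos (by linarith)
  have a := hN1 n hn1
  rw [div_lt_iff₀ (by linarith)] at a
  have hpi : Nat.primeCounting n = #((Finset.Ioc 0 n).filter Nat.Prime) := by
    unfold Nat.primeCounting Nat.primeCounting'
    rw [Nat.count_eq_card_filter_range]
    congr 1
    ext p
    simp only [Finset.mem_filter, Finset.mem_range, Finset.mem_Ioc]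
    constructor
    · rintro ⟨h1, h2⟩; exact ⟨⟨h2.pos, by omega⟩, h2⟩
    · rintro ⟨h1, h2⟩; exact ⟨by omega, h2⟩
  rw [← hpi]
  refine le_trans ?_ (Chebyshev.pi_ge n)
  rw [div_le_div_iff₀ (by positivity) hlog]
  have l2 := Real.log_two_gt_d9
  have l3 : Real.log (n + 1) ≤ 2 * Real.log n := by
    rw [← Real.log_rpow (by linarith)]
    apply Real.log_le_log (by linarith)
    norm_num
    nlinarith
  have : (n:ℝ) ≤ (n * Real.log 2 - Real.log (n+1)) * 2 := by nlinarith
  calc _ ≤ ((n * Real.log 2 - Real.log (n+1)) * 2) * Real.log n := by gcongr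
    _ = _ := by ring

end

section
open Finset MeasureTheory Filter


lemma rom_card_finite (y : ℝ) (N : ℕ) : {n : ℕ | n ∈ Sy y ∧ n ∈ Set.Icc 1 N}.Finite :=
  (Set.finite_Icc 1 N).subset (fun _ h => h.2)

lemma rom_final_arith (n0 L lb K P img E m C1 : ℝ) (hn0 : 0 < n0) (hL : 0 < L) (hlb : 0 < lb) (hK : 0 < K)
    (hP : n0 / (2 * L) ≤ P) (hLK : L ≤ 2 * K * lb) (hm : 0 ≤ m) (hC1 : 0 < C1) (himg : 0 ≤ img)
    (hE : E ≤ 2 * m * K * P + C1 * n0 / L ^ 2 * K ^ 2) (hen : (P * K) ^ 2 ≤ img * E) :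
    n0 ≤ (8 * m * lb + 4 * C1) * img := by
  have hPpos : 0 < P := lt_of_lt_of_le (by positivity) hP
  have h1 : n0 ≤ 2 * L * P := by
    rw [div_le_iff₀ (by positivity)] at hP
    linarith
  have h2 : n0 ≤ 4 * K * lb * P := by
    calc n0 ≤ 2 * L * P := h1
      _ ≤ 2 * (2 * K * lb) * P := by gcongr
      _ = _ := by ring
  have h3 : n0 / L ≤ 2 * P := by
    rw [div_le_iff₀ hL]; linarith
  have h4 : E * n0 ≤ (8 * m * lb + 4 * C1) * (P * K) ^ 2 := by
    calc E * n0 ≤ (2 * m * K * P + C1 * n0 / L ^ 2 * K ^ 2) * n0 := by gcongr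
      _ = 2 * m * K * P * n0 + C1 * K ^ 2 * (n0 / L) ^ 2 := by field_simp
      _ ≤ 2 * m * K * P * (4 * K * lb * P) + C1 * K ^ 2 * (2 * P) ^ 2 := by gcongr
      _ = _ := by ring
  have h5 : (P * K) ^ 2 * n0 ≤ (P * K) ^ 2 * ((8 * m * lb + 4 * C1) * img) := by
    calc (P * K) ^ 2 * n0 ≤ img * E * n0 := by gcongr
      _ = img * (E * n0) := by ring
      _ ≤ img * ((8 * m * lb + 4 * C1) * (P * K) ^ 2) := by gcongr
      _ = _ := by ring
  exact le_of_mul_le_mul_left h5 (by positivity)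

lemma rom_exists_s (K : ℕ) (hK : 1 ≤ K) : ∃ s : ℕ, K ≤ s ^ 4 ∧ s ^ 4 ≤ 16 * K := by
  have hex : ∃ s : ℕ, K ≤ s ^ 4 := ⟨K, Nat.le_self_pow (by norm_num) K⟩
  classical
  refine ⟨Nat.find hex, Nat.find_spec hex, ?_⟩
  have hmin := fun t (ht : t < Nat.find hex) => Nat.find_min hex ht
  generalize Nat.find hex = s at hmin
  rcases Nat.lt_or_ge s 2 with h | h
  · interval_cases s <;> omega
  · obtain ⟨t, rfl⟩ : ∃ t, s = t + 1 := ⟨s - 1, by omega⟩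
    have := hmin t (by omega)
    have h2 : (t + 1) ^ 4 ≤ (2 * t) ^ 4 := Nat.pow_le_pow_left (by omega) 4
    have h3 : (2 * t) ^ 4 = 16 * t ^ 4 := by ring
    omega

lemma rom_image_le (y : ℝ) (hy : 0 ≤ y) (n0 N K : ℕ) (hN : 2 * n0 ≤ N)
    (hF : ∀ k ∈ Finset.Icc 1 K, ⌊y ^ k⌋₊ ≤ n0) :
    #((((Finset.Ioc 0 n0).filter Nat.Prime) ×ˢ (Finset.Icc 1 K)).image (fun t => t.1 + ⌊y ^ t.2⌋₊)) ≤
      Nat.card {n : ℕ | n ∈ Sy y ∧ n ∈ Set.Icc 1 N} := by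
  rw [← Set.ncard_coe_finset]
  change _ ≤ Set.ncard {n : ℕ | n ∈ Sy y ∧ n ∈ Set.Icc 1 N}
  apply Set.ncard_le_ncard _ (rom_card_finite y N)
  intro n hn
  rw [Finset.mem_coe, Finset.mem_image] at hn
  obtain ⟨⟨p, k⟩, ht, rfl⟩ := hn
  rw [Finset.mem_product, Finset.mem_filter, Finset.mem_Ioc] at ht
  obtain ⟨⟨⟨h1, h2⟩, h3⟩, h4⟩ := ht
  have h5 := hF k h4
  simp only at h1 h2 h3 h4 h5 ⊢
  refine ⟨⟨p, k, h3, (Finset.mem_Icc.1 h4).1, ?_⟩, ?_, ?_⟩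
  · push_cast
    rw [Int.natCast_floor_eq_floor (show (0:ℝ) ≤ y ^ k by positivity)]
  · omega
  · omega

lemma rom_delta_pos (w y : ℝ) (b : ℕ) (hw : 1 < w) (hy1 : w ^ 2 ≤ y) (hyb : y < b)
    (H : ∃ s0:ℕ, ∀ s, s0 ≤ s → ∀ q, 1 ≤ q → q ≤ b * s ^ 4 → ∀ c,
      (#((Finset.Icc 1 (s^4)).filter (fun k => ⌊y^k⌋₊ % q = c)) : ℝ) ≤ 8 * (s:ℝ)^4 / q + 2 * (s:ℝ)^2) :
    0 < delta y := by
  obtain ⟨s0, hs0⟩ := H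
  obtain ⟨C, hC, N0, hN0⟩ := rom_pairs_asymp
  obtain ⟨N1, hN1⟩ := rom_pi_lower
  have hwy : w ≤ y := by nlinarith
  have hy0 : 0 < y := by linarith
  have hb1 : (1:ℝ) < b := by linarith
  have hb : 1 < b := by exact_mod_cast hb1
  have hlb : 0 < Real.log b := Real.log_pos hb1
  obtain ⟨m, hm⟩ := pow_unbounded_of_one_lt 2 hw
  set C1 : ℝ := 3 * C * (1 + 32 * (24 + 4 * Real.sqrt b)) with hC1
  have hC1p : 0 < C1 := by positivity
  set C3 : ℝ := 8 * m * Real.log b + 4 * C1 with hC3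
  have hC3p : 0 < C3 := by positivity
  have key : ∀ᶠ N : ℕ in atTop, 1 / (3 * C3) ≤
      (Nat.card {n : ℕ | n ∈ Sy y ∧ n ∈ Set.Icc 1 N} : ℝ) / (N : ℝ) := by
    filter_upwards [eventually_ge_atTop (2 * (N0 + N1 + b ^ (s0 ^ 4 + 1) + 2))] with N hN
    obtain ⟨n0, hn0⟩ : ∃ n0, n0 = N / 2 := ⟨_, rfl⟩
    have hp1 : N0 + N1 + b ^ (s0 ^ 4 + 1) + 2 ≤ n0 := by omega
    have hn02 : 2 * n0 ≤ N := by omega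
    have hn03 : N ≤ 3 * n0 := by omega
    have hn0ne : n0 ≠ 0 := by omega
    obtain ⟨K, hKdef⟩ : ∃ K, K = Nat.log b n0 := ⟨_, rfl⟩
    have hK1 : b ^ K ≤ n0 := hKdef ▸ Nat.pow_log_le_self b hn0ne
    have hK2 : n0 < b ^ (K + 1) := hKdef ▸ Nat.lt_pow_succ_log_self hb n0
    have hK3 : s0 ^ 4 + 1 ≤ K := by
      rw [hKdef]
      exact Nat.le_log_of_pow_le hb (by omega)
    have hK4 : 1 ≤ K := by omega
    obtain ⟨s, hs1, hs2⟩ := rom_exists_s K hK4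
    have hss : s0 ≤ s := by
      by_contra hlt
      push Not at hlt
      have := Nat.pow_le_pow_left hlt.le 4
      omega
    have hFn : ∀ k ∈ Finset.Icc 1 K, ⌊y ^ k⌋₊ ≤ b ^ K := by
      intro k hk
      rw [Finset.mem_Icc] at hk
      have h1 : y ^ k ≤ ((b ^ k : ℕ) : ℝ) := by
        push_cast
        exact pow_le_pow_left₀ hy0.le hyb.le k
      have h2 := Nat.floor_le_of_le h1
      exact h2.trans (Nat.pow_le_pow_right (by omega) hk.2)
    have hn0R : (0:ℝ) < n0 := by exact_mod_cast Nat.pos_of_ne_zero hn0ne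
    have hn0R2 : (1:ℝ) < n0 := by
      have : 1 < n0 := by omega
      exact_mod_cast this
    have hL : 0 < Real.log n0 := Real.log_pos hn0R2
    have hEb := rom_Ebound K s b m n0 (C * n0 / (Real.log n0) ^ 2) (by positivity) (fun k => ⌊y ^ k⌋₊) hs1 hs2
      (hs0 s hss)
      (by
        have : 1 ≤ s ^ 4 := by omega
        nlinarith)
      (by
        intro k hk
        refine (hFn k hk).trans ?_
        calc b ^ K ≤ (2 ^ b) ^ K := Nat.pow_le_pow_left (Nat.lt_two_pow_self).le K
          _ = 2 ^ (b * K) := by rw [pow_mul]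
          _ ≤ 2 ^ (b * s ^ 4) := Nat.pow_le_pow_right (by norm_num) (Nat.mul_le_mul_left b hs1))
      (fun k1 => rom_fiber w y hw hwy m hm.le K k1)
      (fun h hh => hN0 n0 (by omega) h hh)
    have hEl := rom_E_le n0 (Finset.Icc 1 K) (fun k => ⌊y ^ k⌋₊)
    have hen := rom_energy (((Finset.Ioc 0 n0).filter Nat.Prime) ×ˢ (Finset.Icc 1 K)) (fun t => t.1 + ⌊y ^ t.2⌋₊)
    have himg := rom_image_le y hy0.le n0 N K hn02 (fun k hk => (hFn k hk).trans hK1)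
    rw [Finset.card_product, Nat.card_Icc, Nat.add_sub_cancel] at hen
    push_cast at hen
    have hEl2 := (Nat.cast_le (α := ℝ)).2 hEl
    have hfin := rom_final_arith n0 (Real.log n0) (Real.log b) K _ _ _ m C1 hn0R hL hlb
      (by exact_mod_cast hK4) (hN1 n0 (by omega)) 
      (by
        have h1 : (n0:ℝ) ≤ (b:ℝ) ^ (K + 1) := by exact_mod_cast hK2.le
        have h2 := Real.log_le_log hn0R h1
        rw [Real.log_pow] at h2
        push_cast at h2
        have h3 : (1:ℝ) ≤ K := by exact_mod_cast hK4
        nlinarith)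
      (Nat.cast_nonneg m) hC1p (Nat.cast_nonneg _)
      ((hEl2.trans hEb).trans (le_of_eq (by rw [hC1]; ring))) hen
    have himg2 := (Nat.cast_le (α := ℝ)).2 himg
    have hNR : (N:ℝ) ≤ 3 * n0 := by exact_mod_cast hn03
    have hNp : (0:ℝ) < N := by
      have : 0 < N := by omega
      exact_mod_cast this
    rw [div_le_div_iff₀ (by positivity) hNp]
    have := hfin.trans (mul_le_mul_of_nonneg_left himg2 hC3p.le)
    linarith
  have hcob : IsCoboundedUnder (· ≥ ·) atTop (fun N : ℕ =>
    (Nat.card {n : ℕ | n ∈ Sy y ∧ n ∈ Set.Icc 1 N} : ℝ) / (N : ℝ)) := by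
    apply IsBoundedUnder.isCoboundedUnder_ge
    refine isBoundedUnder_of ⟨1, fun N => ?_⟩
    apply div_le_one_of_le₀ _ (Nat.cast_nonneg N)
    norm_cast
    change Set.ncard {n : ℕ | n ∈ Sy y ∧ n ∈ Set.Icc 1 N} ≤ N
    have h1 : Set.ncard {n : ℕ | n ∈ Sy y ∧ n ∈ Set.Icc 1 N} ≤ Set.ncard (Set.Icc 1 N) :=
      Set.ncard_le_ncard (fun _ h => h.2) (Set.finite_Icc 1 N)
    refine h1.trans ?_
    rw [← Finset.coe_Icc, Set.ncard_coe_finset, Nat.card_Icc]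
    omega
  have := le_liminf_of_le hcob key
  exact lt_of_lt_of_le (by positivity) this

lemma rom_ae_final : ∀ᵐ y : ℝ, 1 < y → 0 < delta y := by
  have h1 : ∀ a b : ℕ, ∀ᵐ y : ℝ, (1 + 1 / ((a:ℝ) + 1)) ^ 2 ≤ y → y < b → 0 < delta y := by
    intro a b
    have hw : 1 < 1 + 1 / ((a:ℝ) + 1) := by
      have : 0 < 1 / ((a:ℝ) + 1) := by positivity
      linarith
    by_cases hb : (1 + 1 / ((a:ℝ) + 1)) ^ 2 < b
    · filter_upwards [rom_ae _ (b:ℝ) b hw hb] with y hy h1 h2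
      exact rom_delta_pos _ y b hw h1 h2 (hy ⟨h1, h2⟩)
    · filter_upwards with y h1 h2
      exact absurd (h1.trans_lt h2) hb
  have h2 := ae_all_iff.2 (fun a => ae_all_iff.2 (h1 a))
  filter_upwards [h2] with y hy h1
  obtain ⟨b, hb⟩ := exists_nat_gt y
  have h3 : 0 < (y - 1) / 3 := by linarith
  obtain ⟨a, ha⟩ := exists_nat_one_div_lt h3
  obtain ⟨a', ha'⟩ := exists_nat_one_div_lt h3
  have hpos : 0 < 1 / ((a:ℝ) + 1) := by positivity
  have hle : 1 / ((a:ℝ) + 1) ≤ 1 := by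
    rw [div_le_one (by positivity)]
    have : (0:ℝ) ≤ a := Nat.cast_nonneg a
    linarith
  exact hy a b (by nlinarith) hb


end

/-- The set `𝒴 = {y > 1 : δ_y = 0}` is Lebesgue measurable with Lebesgue measure zero;
equivalently, for almost all `y > 1` one has `δ_y > 0`. -/
theorem stmt0 :
    NullMeasurableSet {y : ℝ | 1 < y ∧ delta y = 0} volume ∧
      volume {y : ℝ | 1 < y ∧ delta y = 0} = 0 := by
  have h0 : volume {y : ℝ | 1 < y ∧ delta y = 0} = 0 := by
    have h := rom_ae_final
    rw [ae_iff] at h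
    refine measure_mono_null ?_ h
    rintro y ⟨h1, h2⟩ h3
    have := h3 h1
    linarith
  exact ⟨NullMeasurableSet.of_null h0, h0⟩
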